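/- arXiv:1011.1355 — 3 statements merged into one kernel-verified Lean document; each statement's English description precedes it below -/
import Mathlib

section
/- Let G be an ε-regular 3-partite 3-complex on V_1 ∪ V_2 ∪ V_3 with all relative densities d_S(G) > d, where 0 < ε ≪ d. Then the absolute density of the top level satisfies d(G_{123}) = |G_{123}|/(|V_1||V_2||V_3|) = (1 ± 8ε)·∏_{S ⊆ {1,2,3}} d_S(G), where the product runs over all nonempty S (with d_∅(G)=1). -/
open Finset

/-- The triangles formed by the three bipartite graphs `G12`, `G13`, `G23`. -/
def tri {V1 V2 V3 : Type} [Fintype V1] [Fintype V2] [Fintype V3]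
    [DecidableEq V1] [DecidableEq V2] [DecidableEq V3]
    (G12 : Finset (V1 × V2)) (G13 : Finset (V1 × V3)) (G23 : Finset (V2 × V3)) :
    Finset (V1 × V2 × V3) :=
  Finset.univ.filter fun t => (t.1, t.2.1) ∈ G12 ∧ (t.1, t.2.2) ∈ G13 ∧ (t.2.1, t.2.2) ∈ G23

/-- `ε`-regularity of the triple part `G123` with respect to the underlying graphs
`G12, G13, G23`: for every subgraph triple spanning more than an `ε`-fraction of the
triangles, the relative density of `G123` on its triangles is within `ε` of the overall
relative density. -/
def triRegular {V1 V2 V3 : Type} [Fintype V1] [Fintype V2] [Fintype V3]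
    [DecidableEq V1] [DecidableEq V2] [DecidableEq V3]
    (G12 : Finset (V1 × V2)) (G13 : Finset (V1 × V3)) (G23 : Finset (V2 × V3))
    (G123 : Finset (V1 × V2 × V3)) (ε : ℝ) : Prop :=
  ∀ J12 ⊆ G12, ∀ J13 ⊆ G13, ∀ J23 ⊆ G23,
    ε * ((tri G12 G13 G23).card : ℝ) < ((tri J12 J13 J23).card : ℝ) →
    |((G123 ∩ tri J12 J13 J23).card : ℝ) / ((tri J12 J13 J23).card : ℝ)
        - (G123.card : ℝ) / ((tri G12 G13 G23).card : ℝ)| ≤ ε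

/-- `ε`-regularity of the bipartite graph `E` between `A` and `B` (relative densities of
large induced subpairs are within `ε` of the overall relative density). -/
def bipRegular {α β : Type} [DecidableEq α] [DecidableEq β]
    (A : Finset α) (B : Finset β) (E : Finset (α × β)) (ε : ℝ) : Prop :=
  ∀ A' ⊆ A, ∀ B' ⊆ B,
    ε * (A.card : ℝ) < (A'.card : ℝ) → ε * (B.card : ℝ) < (B'.card : ℝ) →
    |((E.filter fun p => p.1 ∈ A' ∧ p.2 ∈ B').card : ℝ) / ((A'.card : ℝ) * (B'.card : ℝ))
        - (E.card : ℝ) / ((A.card : ℝ) * (B.card : ℝ))| ≤ ε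

open scoped BigOperators

/-- Functional form of regularity, valid for arbitrary test sets (given by 0/1 functions). -/
def RegF {α β : Type} (S : Finset α) (T : Finset β) (f : α → β → ℝ) (ε C : ℝ) : Prop :=
  ∀ (u : α → ℝ) (v : β → ℝ), (∀ x, u x = 0 ∨ u x = 1) → (∀ y, v y = 0 ∨ v y = 1) →
    |𝔼 x ∈ S, 𝔼 y ∈ T, u x * v y * f x y| ≤ ε * (𝔼 x ∈ S, u x) * (𝔼 y ∈ T, v y) + C * ε ^ 2

lemma extend_small {α : Type} [DecidableEq α] (S : Finset α) (φ : α → ℝ) (ε M : ℝ)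
    (hε : 0 < ε) (hε3 : ε < 1 / 3) (hM : 0 ≤ M)
    (h : ∀ A ⊆ S, ε * (S.card : ℝ) < A.card → |∑ x ∈ A, φ x| ≤ M * A.card)
    (A : Finset α) (hA : A ⊆ S) :
    |∑ x ∈ A, φ x| ≤ M * (A.card + 4 * ε * S.card) := by
  have hS0 : (0 : ℝ) ≤ S.card := Nat.cast_nonneg _
  by_cases hl : ε * (S.card : ℝ) < A.card
  · refine (h A hA hl).trans (mul_le_mul_of_nonneg_left ?_ hM)
    have : 0 ≤ 4 * ε * S.card := by positivity
    linarith
  · push Not at hl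
    rcases A.eq_empty_or_nonempty with rfl | hne
    · simp; positivity
    · have h1 : (1 : ℝ) ≤ A.card := by exact_mod_cast hne.card_pos
      set k := ⌊ε * (S.card : ℝ)⌋₊ + 1 with hk
      have hk1 : ε * (S.card : ℝ) < k := by
        rw [hk]; push_cast; exact Nat.lt_floor_add_one _
      have hk2 : (k : ℝ) ≤ 2 * ε * S.card := by
        have := Nat.floor_le (a := ε * (S.card : ℝ)) (by positivity)
        rw [hk]; push_cast; linarith
      have hcard : k ≤ (S \ A).card := by
        have h2 : ((S \ A).card : ℝ) = S.card - A.card := by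
          rw [Finset.card_sdiff_of_subset hA, Nat.cast_sub (Finset.card_le_card hA)]
        have : (k : ℝ) ≤ (S \ A).card := by rw [h2]; nlinarith
        exact_mod_cast this
      obtain ⟨P, hP, hPc⟩ := Finset.exists_subset_card_eq hcard
      have hdis : Disjoint A P := by
        rw [Finset.disjoint_left]; intro x hx hx'
        exact (Finset.mem_sdiff.1 (hP hx')).2 hx
      have hPS : P ⊆ S := hP.trans Finset.sdiff_subset
      have e1 := h P hPS (by rw [hPc]; exact hk1)
      have e2 := h (A ∪ P) (Finset.union_subset hA hPS) (by
        rw [Finset.card_union_of_disjoint hdis, hPc]; push_cast; linarith)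
      rw [Finset.sum_union hdis, Finset.card_union_of_disjoint hdis, hPc] at e2
      rw [hPc] at e1
      push_cast at e2
      have e3 : M * k ≤ M * (2 * ε * S.card) := mul_le_mul_of_nonneg_left hk2 hM
      rw [abs_le] at *
      constructor <;> nlinarith

lemma regF_of_large {α β : Type} [DecidableEq α] [DecidableEq β] (S : Finset α) (T : Finset β)
    (hS : S.Nonempty) (hT : T.Nonempty)
    (f : α → β → ℝ) (ε : ℝ) (hε : 0 < ε) (hε3 : ε < 1 / 3)
    (h : ∀ A ⊆ S, ∀ B ⊆ T, ε * (S.card : ℝ) < A.card → ε * (T.card : ℝ) < B.card →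
      |∑ x ∈ A, ∑ y ∈ B, f x y| ≤ ε * (A.card * B.card)) :
    RegF S T f ε 24 := by
  intro u v hu hv
  have key : ∀ A ⊆ S, ∀ B ⊆ T, |∑ x ∈ A, ∑ y ∈ B, f x y| ≤
      ε * (A.card + 4 * ε * S.card) * (B.card + 4 * ε * T.card) := by
    intro A hA B hB
    rw [Finset.sum_comm]
    refine extend_small T (fun y => ∑ x ∈ A, f x y) ε _ hε hε3 (by positivity) ?_ B hB
    intro B' hB' hl
    rw [Finset.sum_comm]
    have := extend_small S (fun x => ∑ y ∈ B', f x y) ε (ε * B'.card) hε hε3 (by positivity)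
      (fun A' hA' hl' => by
        refine (h A' hA' B' hB' hl' hl).trans (le_of_eq (by ring))) A hA
    refine this.trans (le_of_eq (by ring))
  set A := S.filter (fun x => u x = 1)
  set B := T.filter (fun y => v y = 1)
  have hs : (0 : ℝ) < S.card := by exact_mod_cast hS.card_pos
  have ht : (0 : ℝ) < T.card := by exact_mod_cast hT.card_pos
  have hAu : ∀ φ : α → ℝ, ∑ x ∈ S, u x * φ x = ∑ x ∈ A, φ x := by
    intro φ
    rw [Finset.sum_filter]
    refine Finset.sum_congr rfl fun x _ => ?_
    rcases hu x with h | h <;> simp [h]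
  have hBv : ∀ φ : β → ℝ, ∑ x ∈ T, v x * φ x = ∑ x ∈ B, φ x := by
    intro φ
    rw [Finset.sum_filter]
    refine Finset.sum_congr rfl fun x _ => ?_
    rcases hv x with h | h <;> simp [h]
  have e1 : 𝔼 x ∈ S, 𝔼 y ∈ T, u x * v y * f x y
      = (∑ x ∈ A, ∑ y ∈ B, f x y) / (S.card * T.card) := by
    simp only [Finset.expect_eq_sum_div_card]
    rw [← hAu, ← Finset.sum_div, div_div, mul_comm (T.card : ℝ)]
    congr 1
    refine Finset.sum_congr rfl fun x _ => ?_
    rw [← hBv, Finset.mul_sum]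
    exact Finset.sum_congr rfl fun y _ => by ring
  have e2 : 𝔼 x ∈ S, u x = A.card / S.card := by
    rw [Finset.expect_eq_sum_div_card]
    have := hAu (fun _ => 1)
    simp at this
    rw [this]
  have e3 : 𝔼 x ∈ T, v x = B.card / T.card := by
    rw [Finset.expect_eq_sum_div_card]
    have := hBv (fun _ => 1)
    simp at this
    rw [this]
  rw [e1, e2, e3, abs_div, abs_of_pos (mul_pos hs ht), div_le_iff₀ (mul_pos hs ht)]
  have hA : A ⊆ S := Finset.filter_subset _ _
  have hB : B ⊆ T := Finset.filter_subset _ _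
  have hAc : (A.card : ℝ) ≤ S.card := by exact_mod_cast Finset.card_le_card hA
  have hBc : (B.card : ℝ) ≤ T.card := by exact_mod_cast Finset.card_le_card hB
  refine (key A hA B hB).trans ?_
  have : (ε * (A.card / S.card) * (B.card / T.card) + 24 * ε ^ 2) * ((S.card : ℝ) * T.card)
    = ε * A.card * B.card + 24 * ε ^ 2 * (S.card * T.card) := by
    field_simp
  rw [this]
  have i1 : ε ^ 2 * (A.card * T.card) ≤ ε ^ 2 * (S.card * (T.card : ℝ)) := by gcongr
  have i2 : ε ^ 2 * (S.card * B.card) ≤ ε ^ 2 * (S.card * (T.card : ℝ)) := by gcongr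
  have i3 : ε ^ 3 * (S.card * (T.card : ℝ)) ≤ ε ^ 2 * (S.card * (T.card : ℝ)) := by
    apply mul_le_mul_of_nonneg_right _ (by positivity)
    nlinarith [sq_nonneg ε]
  nlinarith

lemma sq_bound {β : Type} (T : Finset β) (hT : T.Nonempty) (h : β → ℝ) (ε C : ℝ) (hε : 0 < ε)
    (h1 : ∀ y, |h y| ≤ 1)
    (hr : ∀ v : β → ℝ, (∀ y, v y = 0 ∨ v y = 1) →
      |𝔼 y ∈ T, v y * h y| ≤ ε * (𝔼 y ∈ T, v y) + C * ε ^ 2) :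
    𝔼 y ∈ T, (h y) ^ 2 ≤ (4 + 4 * C) * ε ^ 2 := by
  classical
  set v : β → ℝ := fun y => if 2 * ε < h y then 1 else 0
  set w : β → ℝ := fun y => if h y < - (2 * ε) then 1 else 0
  have a1 := (abs_le.1 (hr v (fun y => by by_cases h : 2 * ε < h y <;> simp [v, h]))).2
  have a2 := (abs_le.1 (hr w (fun y => by by_cases h : h y < -(2 * ε) <;> simp [w, h]))).1
  have b1 : (2 * ε) * 𝔼 y ∈ T, v y ≤ 𝔼 y ∈ T, v y * h y := by
    rw [Finset.mul_expect]
    refine Finset.expect_le_expect fun y _ => ?_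
    simp only [v]; split_ifs <;> linarith
  have b2 : (2 * ε) * 𝔼 y ∈ T, w y ≤ - 𝔼 y ∈ T, w y * h y := by
    rw [Finset.mul_expect, ← Finset.expect_neg_distrib]
    refine Finset.expect_le_expect fun y _ => ?_
    simp only [w]; split_ifs <;> linarith
  have c1 : 𝔼 y ∈ T, (h y) ^ 2 ≤ 𝔼 y ∈ T, (4 * ε ^ 2 + v y * h y - w y * h y) := by
    refine Finset.expect_le_expect fun y _ => ?_
    have := abs_le.1 (h1 y)
    simp only [v, w]; split_ifs <;> nlinarith
  rw [Finset.expect_sub_distrib, Finset.expect_add_distrib, Finset.expect_const hT] at c1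
  linarith

lemma pow_lin (c p : ℝ) (hc0 : 0 ≤ c) (hc1 : c ≤ 1) (hp0 : 0 ≤ p) (hp1 : p ≤ 1) (m : ℕ) :
    |c ^ (m + 1) - p ^ (m + 1) - (m + 1) * p ^ m * (c - p)| ≤ ((m : ℝ) + 1) ^ 2 * (c - p) ^ 2 := by
  induction m with
  | zero => simp; positivity
  | succ m ih =>
    have e : c ^ (m + 1 + 1) - p ^ (m + 1 + 1) - ((m + 1 : ℕ) + 1) * p ^ (m + 1) * (c - p)
      = c * (c ^ (m + 1) - p ^ (m + 1) - (m + 1) * p ^ m * (c - p))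
        + (m + 1) * p ^ m * (c - p) ^ 2 := by push_cast; ring
    rw [e]
    refine (abs_add_le _ _).trans ?_
    rw [abs_mul, abs_of_nonneg hc0]
    have h2 : |((m : ℝ) + 1) * p ^ m * (c - p) ^ 2| ≤ (m + 1) * (c - p) ^ 2 := by
      rw [abs_of_nonneg (by positivity)]
      have := pow_le_one₀ (n := m) hp0 hp1
      apply mul_le_mul_of_nonneg_right _ (sq_nonneg _)
      have : (0 : ℝ) ≤ m + 1 := by positivity
      nlinarith
    have h3 := mul_le_mul hc1 ih (abs_nonneg _) zero_le_one
    push_cast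
    have : 0 ≤ ((m : ℝ) + 2) * (c - p) ^ 2 := by positivity
    nlinarith

lemma RegF.swap {α β : Type} {S : Finset α} {T : Finset β} {f : α → β → ℝ} {ε C : ℝ}
    (h : RegF S T f ε C) : RegF T S (fun y x => f x y) ε C := by
  intro u v hu hv
  have := h v u hv hu
  rw [Finset.expect_comm] at this
  calc _ = |𝔼 y ∈ T, 𝔼 x ∈ S, v x * u y * f x y| := by
        simp only [mul_comm (u _) (v _)]
    _ ≤ _ := this
    _ = _ := by ring

lemma abs_expect_le_one {α : Type} (S : Finset α) (hS : S.Nonempty) (f : α → ℝ)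
    (h : ∀ x, |f x| ≤ 1) : |𝔼 x ∈ S, f x| ≤ 1 :=
  (Finset.abs_expect_le _ _).trans (Finset.expect_le hS fun x _ => h x)

lemma deg_sq {α β : Type} (S : Finset α) (T : Finset β) (hS : S.Nonempty) (hT : T.Nonempty)
    (f : α → β → ℝ) (ε C : ℝ) (hε : 0 < ε) (h : RegF S T f ε C) (h1 : ∀ x y, |f x y| ≤ 1) :
    𝔼 x ∈ S, (𝔼 y ∈ T, f x y) ^ 2 ≤ (4 + 4 * C) * ε ^ 2 := by
  refine sq_bound S hS _ ε C hε (fun x => abs_expect_le_one T hT _ (h1 x)) fun u hu => ?_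
  have := h u (fun _ => 1) hu (fun _ => Or.inr rfl)
  simpa [Finset.mul_expect, Finset.expect_const hT] using this

lemma abs_sub_le_one' {s t : ℝ} (h : s = 0 ∨ s = 1) (h0 : 0 ≤ t) (h1 : t ≤ 1) : |s - t| ≤ 1 := by
  rw [abs_le]; rcases h with h | h <;> constructor <;> linarith

lemma ee_mem {V1 V2 : Type} (S1 : Finset V1) (S2 : Finset V2)
    (hS1 : S1.Nonempty) (hS2 : S2.Nonempty)
    (a : V1 → V2 → ℝ) (ha : ∀ x y, a x y = 0 ∨ a x y = 1) :
    0 ≤ (𝔼 x ∈ S1, 𝔼 y ∈ S2, a x y) ∧ (𝔼 x ∈ S1, 𝔼 y ∈ S2, a x y) ≤ 1 := by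
  constructor
  · refine Finset.expect_nonneg fun x _ => Finset.expect_nonneg fun y _ => ?_
    rcases ha x y with h | h <;> simp [h]
  · refine Finset.expect_le hS1 fun x _ => Finset.expect_le hS2 fun y _ => ?_
    rcases ha x y with h | h <;> simp [h]

lemma cherry {V1 V2 V3 : Type} (S1 : Finset V1) (S2 : Finset V2) (S3 : Finset V3)
    (hS1 : S1.Nonempty) (hS2 : S2.Nonempty) (hS3 : S3.Nonempty)
    (a : V1 → V2 → ℝ) (b : V1 → V3 → ℝ)
    (ha : ∀ x y, a x y = 0 ∨ a x y = 1) (hb : ∀ x y, b x y = 0 ∨ b x y = 1)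
    (ε : ℝ) (hε : 0 < ε) (α β : ℝ) (hα : α = 𝔼 x ∈ S1, 𝔼 y ∈ S2, a x y)
    (hβ : β = 𝔼 x ∈ S1, 𝔼 z ∈ S3, b x z)
    (ra : RegF S1 S2 (fun x y => a x y - α) ε 24) (rb : RegF S1 S3 (fun x y => b x y - β) ε 24) :
    |(𝔼 y ∈ S2, 𝔼 z ∈ S3, 𝔼 x ∈ S1, a x y * b x z) - α * β| ≤ 100 * ε ^ 2 := by
  have hα1 := ee_mem S1 S2 hS1 hS2 a ha
  have hβ1 := ee_mem S1 S3 hS1 hS3 b hb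
  rw [← hα] at hα1
  rw [← hβ] at hβ1
  have d1 := deg_sq S1 S2 hS1 hS2 _ ε 24 hε ra
    (fun x y => abs_sub_le_one' (ha x y) hα1.1 hα1.2)
  have d2 := deg_sq S1 S3 hS1 hS3 _ ε 24 hε rb
    (fun x y => abs_sub_le_one' (hb x y) hβ1.1 hβ1.2)
  have e : (𝔼 y ∈ S2, 𝔼 z ∈ S3, 𝔼 x ∈ S1, a x y * b x z) - α * β
      = 𝔼 x ∈ S1, (𝔼 y ∈ S2, (a x y - α)) * (𝔼 z ∈ S3, (b x z - β)) := by
    have e1 : (𝔼 y ∈ S2, 𝔼 z ∈ S3, 𝔼 x ∈ S1, a x y * b x z)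
        = 𝔼 x ∈ S1, (𝔼 y ∈ S2, a x y) * (𝔼 z ∈ S3, b x z) := by
      rw [Finset.expect_congr rfl fun y _ => Finset.expect_comm S3 S1 _, Finset.expect_comm]
      refine Finset.expect_congr rfl fun x _ => ?_
      rw [Finset.expect_mul_expect]
    rw [e1]
    have e2 : ∀ x ∈ S1, (𝔼 y ∈ S2, (a x y - α)) * (𝔼 z ∈ S3, (b x z - β))
        = (𝔼 y ∈ S2, a x y) * (𝔼 z ∈ S3, b x z) - β * (𝔼 y ∈ S2, a x y)
          - α * (𝔼 z ∈ S3, b x z) + α * β := by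
      intro x _
      rw [Finset.expect_sub_distrib, Finset.expect_sub_distrib, Finset.expect_const hS2,
        Finset.expect_const hS3]
      ring
    rw [Finset.expect_congr rfl e2, Finset.expect_add_distrib, Finset.expect_sub_distrib,
      Finset.expect_sub_distrib, ← Finset.mul_expect, ← Finset.mul_expect, ← hα, ← hβ,
      Finset.expect_const hS1]
    ring
  rw [e]
  refine (Finset.abs_expect_le _ _).trans ?_
  have : 𝔼 x ∈ S1, |(𝔼 y ∈ S2, (a x y - α)) * (𝔼 z ∈ S3, (b x z - β))| ≤
      𝔼 x ∈ S1, ((1 / 2) * (𝔼 y ∈ S2, (a x y - α)) ^ 2 + (1 / 2) * (𝔼 z ∈ S3, (b x z - β)) ^ 2) := by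
    refine Finset.expect_le_expect fun x _ => ?_
    generalize (𝔼 y ∈ S2, (a x y - α)) = s
    generalize (𝔼 z ∈ S3, (b x z - β)) = t
    rw [abs_le]
    constructor <;> nlinarith [sq_nonneg (s - t), sq_nonneg (s + t)]
  rw [Finset.expect_add_distrib, ← Finset.mul_expect, ← Finset.mul_expect] at this
  linarith

lemma codeg_sq {V1 V2 V3 : Type} (S1 : Finset V1) (S2 : Finset V2) (S3 : Finset V3)
    (hS1 : S1.Nonempty) (hS2 : S2.Nonempty) (hS3 : S3.Nonempty)
    (a : V1 → V2 → ℝ) (b : V1 → V3 → ℝ)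
    (ha : ∀ x y, a x y = 0 ∨ a x y = 1) (hb : ∀ x y, b x y = 0 ∨ b x y = 1)
    (ε : ℝ) (hε : 0 < ε) (α β : ℝ) (hα : α = 𝔼 x ∈ S1, 𝔼 y ∈ S2, a x y)
    (hβ : β = 𝔼 x ∈ S1, 𝔼 z ∈ S3, b x z)
    (ra : RegF S1 S2 (fun x y => a x y - α) ε 24) (rb : RegF S1 S3 (fun x y => b x y - β) ε 24) :
    𝔼 y ∈ S2, 𝔼 z ∈ S3, ((𝔼 x ∈ S1, a x y * b x z) - α * β) ^ 2 ≤ 400 * ε ^ 2 := by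
  have hα1 := ee_mem S1 S2 hS1 hS2 a ha
  have hβ1 := ee_mem S1 S3 hS1 hS3 b hb
  rw [← hα] at hα1
  rw [← hβ] at hβ1
  have d1 := deg_sq S2 S1 hS2 hS1 _ ε 24 hε ra.swap
    (fun y x => abs_sub_le_one' (ha x y) hα1.1 hα1.2)
  have d2 : ∀ y, 𝔼 z ∈ S3, (𝔼 x ∈ S1, a x y * (b x z - β)) ^ 2 ≤ (4 + 4 * 24) * ε ^ 2 := by
    intro y
    refine sq_bound S3 hS3 _ ε 24 hε (fun z => abs_expect_le_one S1 hS1 _ fun x => ?_) ?_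
    · have := abs_sub_le_one' (hb x z) hβ1.1 hβ1.2
      rcases ha x y with h | h <;> simp [h, this]
    · intro v hv
      have h1 := rb (fun x => a x y) v (fun x => ha x y) hv
      rw [Finset.expect_comm] at h1
      have e : 𝔼 z ∈ S3, v z * 𝔼 x ∈ S1, a x y * (b x z - β)
          = 𝔼 z ∈ S3, 𝔼 x ∈ S1, a x y * v z * (b x z - β) := by
        refine Finset.expect_congr rfl fun z _ => ?_
        rw [Finset.mul_expect]
        exact Finset.expect_congr rfl fun x _ => by ring
      rw [e]
      refine h1.trans ?_
      have h2 : 𝔼 x ∈ S1, a x y ≤ 1 := Finset.expect_le hS1 fun x _ => by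
        rcases ha x y with h | h <;> simp [h]
      have h3 : 0 ≤ 𝔼 z ∈ S3, v z := Finset.expect_nonneg fun z _ => by
        rcases hv z with h | h <;> simp [h]
      have : ε * (𝔼 x ∈ S1, a x y) * (𝔼 z ∈ S3, v z) ≤ ε * 1 * (𝔼 z ∈ S3, v z) := by gcongr
      linarith
  have hp : ∀ y z, ((𝔼 x ∈ S1, a x y * b x z) - α * β) ^ 2 ≤
      2 * (𝔼 x ∈ S1, a x y * (b x z - β)) ^ 2 + 2 * (𝔼 x ∈ S1, (a x y - α)) ^ 2 := by
    intro y z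
    have e1 : (𝔼 x ∈ S1, a x y * b x z) - α * β =
        (𝔼 x ∈ S1, a x y * (b x z - β)) + β * (𝔼 x ∈ S1, (a x y - α)) := by
      have : 𝔼 x ∈ S1, a x y * (b x z - β)
          = (𝔼 x ∈ S1, a x y * b x z) - β * 𝔼 x ∈ S1, a x y := by
        rw [Finset.mul_expect, ← Finset.expect_sub_distrib]
        exact Finset.expect_congr rfl fun x _ => by ring
      rw [this, Finset.expect_sub_distrib, Finset.expect_const hS1]
      ring
    rw [e1]
    generalize (𝔼 x ∈ S1, a x y * (b x z - β)) = s
    generalize (𝔼 x ∈ S1, (a x y - α)) = t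
    have : β ^ 2 ≤ 1 := by nlinarith
    nlinarith [sq_nonneg (s - β * t), mul_le_mul_of_nonneg_right this (sq_nonneg t)]
  calc _ ≤ 𝔼 y ∈ S2, (2 * ((4 + 4 * 24) * ε ^ 2) + 2 * (𝔼 x ∈ S1, (a x y - α)) ^ 2) := by
        refine Finset.expect_le_expect fun y _ => ?_
        refine (Finset.expect_le_expect fun z _ => hp y z).trans ?_
        rw [Finset.expect_add_distrib, Finset.expect_const hS3, ← Finset.mul_expect]
        have := d2 y
        linarith
    _ ≤ _ := by
        rw [Finset.expect_add_distrib, Finset.expect_const hS2, ← Finset.mul_expect]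
        linarith

/-- The tensor-power step. -/
lemma power_step {V1 V2 V3 : Type} (S1 : Finset V1) (S2 : Finset V2) (S3 : Finset V3)
    (a : V1 → V2 → ℝ) (b : V1 → V3 → ℝ)
    (ha : ∀ x y, a x y = 0 ∨ a x y = 1) (hb : ∀ x y, b x y = 0 ∨ b x y = 1)
    (ε : ℝ) (w : V2 → V3 → ℝ) (hw : RegF S2 S3 w ε 24) (hS1 : S1.Nonempty) (M : ℕ) :
    |𝔼 y ∈ S2, 𝔼 z ∈ S3, w y z * (𝔼 x ∈ S1, a x y * b x z) ^ M|
      ≤ ε * (𝔼 y ∈ S2, 𝔼 z ∈ S3, (𝔼 x ∈ S1, a x y * b x z) ^ M) + 24 * ε ^ 2 := by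
  set P := Fintype.piFinset fun _ : Fin M => S1 with hP
  have hPne : P.Nonempty := by
    obtain ⟨x, hx⟩ := hS1
    exact ⟨fun _ => x, by simp [hP, hx]⟩
  have hpow : ∀ y z, (𝔼 x ∈ S1, a x y * b x z) ^ M
      = 𝔼 q ∈ P, (∏ i, a (q i) y) * (∏ i, b (q i) z) := by
    intro y z
    rw [Finset.expect_pow]
    exact Finset.expect_congr rfl fun q _ => Finset.prod_mul_distrib
  have h01 : ∀ (s : Fin M → ℝ), (∀ i, s i = 0 ∨ s i = 1) → (∏ i, s i) = 0 ∨ (∏ i, s i) = 1 := by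
    intro s hs
    by_cases h : ∃ i, s i = 0
    · obtain ⟨i, hi⟩ := h
      exact Or.inl (Finset.prod_eq_zero (Finset.mem_univ i) hi)
    · push Not at h
      exact Or.inr (Finset.prod_eq_one fun i _ => (hs i).resolve_left (h i))
  have e1 : 𝔼 y ∈ S2, 𝔼 z ∈ S3, w y z * (𝔼 x ∈ S1, a x y * b x z) ^ M
      = 𝔼 q ∈ P, 𝔼 y ∈ S2, 𝔼 z ∈ S3, (∏ i, a (q i) y) * (∏ i, b (q i) z) * w y z := by
    rw [Finset.expect_comm P S2]
    refine Finset.expect_congr rfl fun y _ => ?_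
    rw [Finset.expect_comm P S3]
    refine Finset.expect_congr rfl fun z _ => ?_
    rw [hpow, Finset.mul_expect]
    exact Finset.expect_congr rfl fun q _ => by ring
  have e2 : 𝔼 y ∈ S2, 𝔼 z ∈ S3, (𝔼 x ∈ S1, a x y * b x z) ^ M
      = 𝔼 q ∈ P, (𝔼 y ∈ S2, (∏ i, a (q i) y)) * (𝔼 z ∈ S3, (∏ i, b (q i) z)) := by
    simp only [Finset.expect_mul_expect]
    rw [Finset.expect_comm P S2]
    refine Finset.expect_congr rfl fun y _ => ?_
    rw [Finset.expect_comm P S3]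
    exact Finset.expect_congr rfl fun z _ => hpow y z
  rw [e1, e2]
  refine (Finset.abs_expect_le _ _).trans ?_
  refine (Finset.expect_le_expect fun q _ => hw (fun y => ∏ i, a (q i) y) (fun z => ∏ i, b (q i) z)
    (fun y => h01 _ fun i => ha _ _) (fun z => h01 _ fun i => hb _ _)).trans ?_
  rw [Finset.expect_add_distrib, Finset.expect_const hPne, Finset.mul_expect]
  simp only [mul_assoc]
  exact le_rfl

lemma weighted {V1 V2 V3 : Type} (S1 : Finset V1) (S2 : Finset V2) (S3 : Finset V3)
    (hS1 : S1.Nonempty) (hS2 : S2.Nonempty) (hS3 : S3.Nonempty)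
    (a : V1 → V2 → ℝ) (b : V1 → V3 → ℝ)
    (ha : ∀ x y, a x y = 0 ∨ a x y = 1) (hb : ∀ x y, b x y = 0 ∨ b x y = 1)
    (ε : ℝ) (hε : 0 < ε) (hε1 : ε < 1 / 3) (α β : ℝ)
    (hα : α = 𝔼 x ∈ S1, 𝔼 y ∈ S2, a x y) (hβ : β = 𝔼 x ∈ S1, 𝔼 z ∈ S3, b x z)
    (ra : RegF S1 S2 (fun x y => a x y - α) ε 24) (rb : RegF S1 S3 (fun x y => b x y - β) ε 24)
    (w : V2 → V3 → ℝ) (hw : RegF S2 S3 w ε 24) (hw1 : ∀ y z, |w y z| ≤ 1)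
    (hw0 : 𝔼 y ∈ S2, 𝔼 z ∈ S3, w y z = 0) (m : ℕ) :
    ((m : ℝ) + 1) * (α * β) ^ m * |𝔼 y ∈ S2, 𝔼 z ∈ S3, w y z * (𝔼 x ∈ S1, a x y * b x z)|
      ≤ ε * (α * β) ^ (m + 1) + 1000 * ((m : ℝ) + 1) ^ 2 * ε ^ 2 := by
  have hα1 := ee_mem S1 S2 hS1 hS2 a ha
  have hβ1 := ee_mem S1 S3 hS1 hS3 b hb
  rw [← hα] at hα1
  rw [← hβ] at hβ1
  have hch := cherry S1 S2 S3 hS1 hS2 hS3 a b ha hb ε hε α β hα hβ ra rb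
  have hQ := codeg_sq S1 S2 S3 hS1 hS2 hS3 a b ha hb ε hε α β hα hβ ra rb
  have hps := power_step S1 S2 S3 a b ha hb ε w hw hS1 (m + 1)
  set p := α * β with hp
  have hp0 : 0 ≤ p := mul_nonneg hα1.1 hβ1.1
  have hp1 : p ≤ 1 := mul_le_one₀ hα1.2 hβ1.1 hβ1.2
  set c : V2 → V3 → ℝ := fun y z => 𝔼 x ∈ S1, a x y * b x z with hc
  have hc0 : ∀ y z, 0 ≤ c y z := fun y z => Finset.expect_nonneg fun x _ => by
    rcases ha x y with h | h <;> rcases hb x z with h' | h' <;> simp [h, h']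
  have hc1 : ∀ y z, c y z ≤ 1 := fun y z => Finset.expect_le hS1 fun x _ => by
    rcases ha x y with h | h <;> rcases hb x z with h' | h' <;> simp [h, h']
  change |𝔼 y ∈ S2, 𝔼 z ∈ S3, w y z * c y z ^ (m + 1)| ≤
    ε * (𝔼 y ∈ S2, 𝔼 z ∈ S3, c y z ^ (m + 1)) + 24 * ε ^ 2 at hps
  change |(𝔼 y ∈ S2, 𝔼 z ∈ S3, c y z) - p| ≤ 100 * ε ^ 2 at hch
  change 𝔼 y ∈ S2, 𝔼 z ∈ S3, (c y z - p) ^ 2 ≤ 400 * ε ^ 2 at hQ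
  change ((m : ℝ) + 1) * p ^ m * |𝔼 y ∈ S2, 𝔼 z ∈ S3, w y z * c y z| ≤ _
  have hlin := fun y z => pow_lin (c y z) p (hc0 y z) (hc1 y z) hp0 hp1 m
  set K := ((m : ℝ) + 1) with hK
  have hK1 : 1 ≤ K := by simp [hK]
  set R : V2 → V3 → ℝ := fun y z => c y z ^ (m + 1) - p ^ (m + 1) - K * p ^ m * (c y z - p) with hR
  have hpm : p ^ m ≤ 1 := pow_le_one₀ hp0 hp1
  have hpm0 : 0 ≤ p ^ m := pow_nonneg hp0 m
  -- the upper bound for the mean of `c ^ (m+1)`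
  have hup : 𝔼 y ∈ S2, 𝔼 z ∈ S3, c y z ^ (m + 1) ≤
      p ^ (m + 1) + K * (100 * ε ^ 2) + K ^ 2 * (400 * ε ^ 2) := by
    have : 𝔼 y ∈ S2, 𝔼 z ∈ S3, c y z ^ (m + 1) ≤
        𝔼 y ∈ S2, 𝔼 z ∈ S3, (p ^ (m + 1) + K * p ^ m * (c y z - p) + K ^ 2 * (c y z - p) ^ 2) := by
      refine Finset.expect_le_expect fun y _ => Finset.expect_le_expect fun z _ => ?_
      have := (abs_le.1 (hlin y z)).2
      linarith
    simp only [Finset.expect_add_distrib, Finset.expect_sub_distrib, ← Finset.mul_expect,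
      Finset.expect_const hS2, Finset.expect_const hS3] at this
    have h1 : K * p ^ m * ((𝔼 y ∈ S2, 𝔼 z ∈ S3, c y z) - p) ≤ K * (100 * ε ^ 2) := by
      have h2 : K * p ^ m * ((𝔼 y ∈ S2, 𝔼 z ∈ S3, c y z) - p) ≤ K * p ^ m * (100 * ε ^ 2) :=
        mul_le_mul_of_nonneg_left ((le_abs_self _).trans hch) (by positivity)
      have h3 : K * p ^ m * (100 * ε ^ 2) ≤ K * 1 * (100 * ε ^ 2) := by gcongr
      linarith
    have h2 : K ^ 2 * (𝔼 y ∈ S2, 𝔼 z ∈ S3, (c y z - p) ^ 2) ≤ K ^ 2 * (400 * ε ^ 2) := by gcongr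
    linarith
  have hWR : |𝔼 y ∈ S2, 𝔼 z ∈ S3, w y z * R y z| ≤ K ^ 2 * (400 * ε ^ 2) := by
    have h1 : |𝔼 y ∈ S2, 𝔼 z ∈ S3, w y z * R y z|
        ≤ 𝔼 y ∈ S2, 𝔼 z ∈ S3, K ^ 2 * (c y z - p) ^ 2 := by
      refine (Finset.abs_expect_le _ _).trans (Finset.expect_le_expect fun y _ => ?_)
      refine (Finset.abs_expect_le _ _).trans (Finset.expect_le_expect fun z _ => ?_)
      rw [abs_mul]
      have := mul_le_mul (hw1 y z) (hlin y z) (abs_nonneg _) zero_le_one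
      rwa [one_mul] at this
    simp only [← Finset.mul_expect] at h1
    refine h1.trans ?_
    gcongr
  have hid : K * p ^ m * (𝔼 y ∈ S2, 𝔼 z ∈ S3, w y z * c y z)
      = (𝔼 y ∈ S2, 𝔼 z ∈ S3, w y z * c y z ^ (m + 1)) - 𝔼 y ∈ S2, 𝔼 z ∈ S3, w y z * R y z := by
    have h1 : 𝔼 y ∈ S2, 𝔼 z ∈ S3, w y z * R y z = 𝔼 y ∈ S2, 𝔼 z ∈ S3,
        (w y z * c y z ^ (m + 1) - (p ^ (m + 1) - K * p ^ m * p) * w y z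
          - K * p ^ m * (w y z * c y z)) := by
      refine Finset.expect_congr rfl fun y _ => Finset.expect_congr rfl fun z _ => ?_
      simp only [hR]; ring
    simp only [Finset.expect_sub_distrib, ← Finset.mul_expect, hw0] at h1
    rw [h1]; ring
  have hfin : K * p ^ m * |𝔼 y ∈ S2, 𝔼 z ∈ S3, w y z * c y z| ≤
      ε * (p ^ (m + 1) + K * (100 * ε ^ 2) + K ^ 2 * (400 * ε ^ 2)) + 24 * ε ^ 2
        + K ^ 2 * (400 * ε ^ 2) := by
    have h1 : K * p ^ m * |𝔼 y ∈ S2, 𝔼 z ∈ S3, w y z * c y z|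
        = |K * p ^ m * (𝔼 y ∈ S2, 𝔼 z ∈ S3, w y z * c y z)| := by
      rw [abs_mul, abs_of_nonneg (by positivity : 0 ≤ K * p ^ m)]
    rw [h1, hid]
    refine (abs_sub _ _).trans ?_
    have := mul_le_mul_of_nonneg_left hup hε.le
    linarith
  refine hfin.trans ?_
  have hKK : K ≤ K ^ 2 := by nlinarith
  have j1 : ε * (K * (100 * ε ^ 2) + K ^ 2 * (400 * ε ^ 2)) ≤ (1 / 3) * (500 * K ^ 2 * ε ^ 2) := by
    apply mul_le_mul hε1.le _ (by positivity) (by norm_num)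
    nlinarith [sq_nonneg ε]
  have j2 : 24 * ε ^ 2 ≤ 24 * K ^ 2 * ε ^ 2 := by
    have : (1 : ℝ) ≤ K ^ 2 := by nlinarith
    nlinarith [sq_nonneg ε]
  have j3 : 0 ≤ K ^ 2 * ε ^ 2 := by positivity
  nlinarith


lemma ind_sum {α β : Type} [DecidableEq α] [DecidableEq β] (E : Finset (α × β))
    (A : Finset α) (B : Finset β) :
    ∑ x ∈ A, ∑ y ∈ B, (if (x, y) ∈ E then (1 : ℝ) else 0)
      = ((E.filter fun p => p.1 ∈ A ∧ p.2 ∈ B).card : ℝ) := by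
  rw [← Finset.sum_product', Finset.sum_boole]
  congr 2
  ext ⟨x, y⟩
  simp only [Finset.mem_filter, Finset.mem_product]
  tauto

lemma ind_expect {α β : Type} [DecidableEq α] [DecidableEq β] (E : Finset (α × β))
    (S : Finset α) (T : Finset β) (hE : E ⊆ S ×ˢ T) :
    𝔼 x ∈ S, 𝔼 y ∈ T, (if (x, y) ∈ E then (1 : ℝ) else 0)
      = (E.card : ℝ) / ((S.card : ℝ) * T.card) := by
  simp only [Finset.expect_eq_sum_div_card]
  rw [← Finset.sum_div, ind_sum, div_div, mul_comm (T.card : ℝ)]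
  congr 3
  refine Finset.filter_true_of_mem fun p hp => ?_
  exact Finset.mem_product.1 (hE hp)

lemma bip_regF {α β : Type} [DecidableEq α] [DecidableEq β] (S : Finset α) (T : Finset β)
    (E : Finset (α × β)) (ε : ℝ) (hε : 0 < ε) (hε3 : ε < 1 / 3)
    (hS : S.Nonempty) (hT : T.Nonempty) (h : bipRegular S T E ε) :
    RegF S T (fun x y => (if (x, y) ∈ E then (1 : ℝ) else 0)
      - (E.card : ℝ) / ((S.card : ℝ) * T.card)) ε 24 := by
  refine regF_of_large S T hS hT _ ε hε hε3 fun A hA B hB lA lB => ?_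
  have h1 := h A hA B hB lA lB
  have pA : (0 : ℝ) < A.card := lt_of_le_of_lt (by positivity) lA
  have pB : (0 : ℝ) < B.card := lt_of_le_of_lt (by positivity) lB
  simp only [Finset.sum_sub_distrib, Finset.sum_const, nsmul_eq_mul]
  rw [ind_sum]
  generalize ((E.card : ℝ) / ((S.card : ℝ) * T.card)) = δ at *
  generalize ((E.filter fun p => p.1 ∈ A ∧ p.2 ∈ B).card : ℝ) = e at *
  have : e - A.card * (B.card * δ) = (e / (A.card * B.card) - δ) * (A.card * B.card) := by
    field_simp
  rw [this, abs_mul, abs_of_pos (mul_pos pA pB)]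
  exact mul_le_mul_of_nonneg_right h1 (by positivity)

lemma tri_expect {V1 V2 V3 : Type} [Fintype V1] [Fintype V2] [Fintype V3]
    [DecidableEq V1] [DecidableEq V2] [DecidableEq V3]
    (G1 : Finset V1) (G2 : Finset V2) (G3 : Finset V3)
    (G12 : Finset (V1 × V2)) (G13 : Finset (V1 × V3)) (G23 : Finset (V2 × V3))
    (h12 : G12 ⊆ G1 ×ˢ G2) (h13 : G13 ⊆ G1 ×ˢ G3) :
    𝔼 y ∈ G2, 𝔼 z ∈ G3, (if (y, z) ∈ G23 then (1 : ℝ) else 0) *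
      (𝔼 x ∈ G1, (if (x, y) ∈ G12 then (1 : ℝ) else 0) * (if (x, z) ∈ G13 then (1 : ℝ) else 0))
    = ((tri G12 G13 G23).card : ℝ) / ((G1.card : ℝ) * G2.card * G3.card) := by
  have e1 : ∀ y z, (if (y, z) ∈ G23 then (1 : ℝ) else 0) *
      (𝔼 x ∈ G1, (if (x, y) ∈ G12 then (1 : ℝ) else 0) * (if (x, z) ∈ G13 then (1 : ℝ) else 0))
      = 𝔼 x ∈ G1, (if (x, y, z) ∈ tri G12 G13 G23 then (1 : ℝ) else 0) := by
    intro y z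
    rw [Finset.mul_expect]
    refine Finset.expect_congr rfl fun x _ => ?_
    simp only [tri, Finset.mem_filter, Finset.mem_univ, true_and]
    by_cases h1 : (y, z) ∈ G23 <;> by_cases h2 : (x, y) ∈ G12 <;> by_cases h3 : (x, z) ∈ G13 <;>
      simp [h1, h2, h3]
  simp only [e1]
  rw [Finset.expect_congr rfl fun y _ => Finset.expect_comm G3 G1 _, Finset.expect_comm]
  simp only [Finset.expect_eq_sum_div_card]
  simp only [← Finset.sum_div]
  rw [div_div, div_div]
  congr 1
  · simp only [← Finset.sum_product']
    rw [Finset.sum_boole]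
    congr 2
    ext ⟨x, y, z⟩
    simp only [Finset.mem_filter, Finset.mem_product]
    refine ⟨fun h => h.2, fun h => ⟨?_, h⟩⟩
    simp only [tri, Finset.mem_filter, Finset.mem_univ, true_and] at h
    have i1 := Finset.mem_product.1 (h12 h.1)
    have i2 := Finset.mem_product.1 (h13 h.2.1)
    exact ⟨i1.1, i1.2, i2.2⟩
  · ring

/-- The triangle counting estimate, with the multiplicative error `1 ± 8 ε`. -/
lemma tri_count (d : ℝ) (hd : 0 < d) (m : ℕ) (hm : 1 ≤ d * ((m : ℝ) + 1)) (ε : ℝ) (hε : 0 < ε)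
    (hε1 : ε < 1 / 3) (hε2 : ε < d ^ 2 / 100)
    (hε3 : ε < d ^ (2 * m + 3) / (1000 * ((m : ℝ) + 1)))
    {V1 V2 V3 : Type} [Fintype V1] [Fintype V2] [Fintype V3]
    [DecidableEq V1] [DecidableEq V2] [DecidableEq V3]
    (G1 : Finset V1) (G2 : Finset V2) (G3 : Finset V3)
    (G12 : Finset (V1 × V2)) (G13 : Finset (V1 × V3)) (G23 : Finset (V2 × V3))
    (h12 : G12 ⊆ G1 ×ˢ G2) (h13 : G13 ⊆ G1 ×ˢ G3) (h23 : G23 ⊆ G2 ×ˢ G3)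
    (n1 : G1.Nonempty) (n2 : G2.Nonempty) (n3 : G3.Nonempty)
    (α β γ : ℝ) (hα : α = (G12.card : ℝ) / ((G1.card : ℝ) * (G2.card : ℝ)))
    (hβ : β = (G13.card : ℝ) / ((G1.card : ℝ) * (G3.card : ℝ)))
    (hγ : γ = (G23.card : ℝ) / ((G2.card : ℝ) * (G3.card : ℝ)))
    (dα : d < α) (dβ : d < β) (dγ : d < γ)
    (r12 : bipRegular G1 G2 G12 ε) (r13 : bipRegular G1 G3 G13 ε) (r23 : bipRegular G2 G3 G23 ε) :
    |((tri G12 G13 G23).card : ℝ) / ((G1.card : ℝ) * G2.card * G3.card) - α * β * γ|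
      ≤ 8 * ε * (α * β * γ) := by
  have ra := bip_regF G1 G2 G12 ε hε hε1 n1 n2 r12
  have rb := bip_regF G1 G3 G13 ε hε hε1 n1 n3 r13
  have rg := bip_regF G2 G3 G23 ε hε hε1 n2 n3 r23
  rw [← hα] at ra
  rw [← hβ] at rb
  rw [← hγ] at rg
  rw [← ind_expect G12 G1 G2 h12] at hα
  rw [← ind_expect G13 G1 G3 h13] at hβ
  rw [← ind_expect G23 G2 G3 h23] at hγ
  rw [← tri_expect G1 G2 G3 G12 G13 G23 h12 h13]
  set a : V1 → V2 → ℝ := fun x y => if (x, y) ∈ G12 then (1 : ℝ) else 0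
  set b : V1 → V3 → ℝ := fun x y => if (x, y) ∈ G13 then (1 : ℝ) else 0
  set g : V2 → V3 → ℝ := fun x y => if (x, y) ∈ G23 then (1 : ℝ) else 0
  have ha : ∀ x y, a x y = 0 ∨ a x y = 1 := fun x y => by
    by_cases h : (x, y) ∈ G12 <;> simp [a, h]
  have hb : ∀ x y, b x y = 0 ∨ b x y = 1 := fun x y => by
    by_cases h : (x, y) ∈ G13 <;> simp [b, h]
  have hg : ∀ x y, g x y = 0 ∨ g x y = 1 := fun x y => by
    by_cases h : (x, y) ∈ G23 <;> simp [g, h]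
  change α = 𝔼 x ∈ G1, 𝔼 y ∈ G2, a x y at hα
  change β = 𝔼 x ∈ G1, 𝔼 y ∈ G3, b x y at hβ
  change γ = 𝔼 x ∈ G2, 𝔼 y ∈ G3, g x y at hγ
  change RegF G1 G2 (fun x y => a x y - α) ε 24 at ra
  change RegF G1 G3 (fun x y => b x y - β) ε 24 at rb
  change RegF G2 G3 (fun x y => g x y - γ) ε 24 at rg
  change |(𝔼 y ∈ G2, 𝔼 z ∈ G3, g y z * (𝔼 x ∈ G1, a x y * b x z)) - α * β * γ| ≤ _
  have hγ1 := ee_mem G2 G3 n2 n3 g hg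
  rw [← hγ] at hγ1
  have hw0 : 𝔼 y ∈ G2, 𝔼 z ∈ G3, (g y z - γ) = 0 := by
    simp only [Finset.expect_sub_distrib, Finset.expect_const n2, Finset.expect_const n3]
    rw [← hγ]; ring
  have hW := weighted G1 G2 G3 n1 n2 n3 a b ha hb ε hε hε1 α β hα hβ ra rb _ rg
    (fun y z => abs_sub_le_one' (hg y z) hγ1.1 hγ1.2) hw0 m
  have hch := cherry G1 G2 G3 n1 n2 n3 a b ha hb ε hε α β hα hβ ra rb
  have hsplit : 𝔼 y ∈ G2, 𝔼 z ∈ G3, (g y z - γ) * (𝔼 x ∈ G1, a x y * b x z)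
      = (𝔼 y ∈ G2, 𝔼 z ∈ G3, g y z * (𝔼 x ∈ G1, a x y * b x z))
        - γ * 𝔼 y ∈ G2, 𝔼 z ∈ G3, 𝔼 x ∈ G1, a x y * b x z := by
    simp only [sub_mul, Finset.expect_sub_distrib, ← Finset.mul_expect]
  rw [hsplit] at hW
  generalize (𝔼 y ∈ G2, 𝔼 z ∈ G3, g y z * (𝔼 x ∈ G1, a x y * b x z)) = τ at *
  generalize (𝔼 y ∈ G2, 𝔼 z ∈ G3, 𝔼 x ∈ G1, a x y * b x z) = κ at *
  have pdp : d ^ 2 ≤ α * β := by nlinarith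
  set p := α * β with hp
  set K := (m : ℝ) + 1 with hK
  have hK0 : 0 < K := by positivity
  have hp0 : 0 < p := lt_of_lt_of_le (by positivity) pdp
  have hpm : 0 < p ^ m := pow_pos hp0 m
  have hγ0 : 0 < γ := hd.trans dγ
  have W1 : |τ - γ * κ| ≤ 2 * ε * (p * γ) := by
    have h1 : ε * p ^ (m + 1) ≤ K * p ^ m * (ε * (p * γ)) := by
      have : 1 ≤ γ * K := hm.trans (by gcongr)
      have h2 : ε * p ^ (m + 1) * 1 ≤ ε * p ^ (m + 1) * (γ * K) := by gcongr
      calc _ ≤ _ := by simpa using h2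
        _ = _ := by ring
    have h2 : 1000 * K ^ 2 * ε ^ 2 ≤ K * p ^ m * (ε * (p * γ)) := by
      rw [lt_div_iff₀ (by positivity)] at hε3
      have h3 : d ^ (2 * m + 3) ≤ p ^ (m + 1) * γ := by
        have : d ^ (2 * m + 3) = (d ^ 2) ^ (m + 1) * d := by ring
        rw [this]
        gcongr
      have h4 : ε * (1000 * K) * (K * ε) ≤ p ^ (m + 1) * γ * (K * ε) := by
        apply mul_le_mul_of_nonneg_right (hε3.le.trans h3) (by positivity)
      calc _ = ε * (1000 * K) * (K * ε) := by ring
        _ ≤ _ := h4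
        _ = _ := by ring
    have h3 : K * p ^ m * |τ - γ * κ| ≤ K * p ^ m * (2 * ε * (p * γ)) := by linarith
    exact le_of_mul_le_mul_left h3 (by positivity)
  have W2 : |γ * κ - p * γ| ≤ ε * (p * γ) := by
    have : γ * κ - p * γ = γ * (κ - p) := by ring
    rw [this, abs_mul, abs_of_pos hγ0]
    have h1 : 100 * ε ^ 2 ≤ ε * p := by nlinarith
    have := mul_le_mul_of_nonneg_left (hch.trans h1) hγ0.le
    linarith
  have tr := abs_sub_le τ (γ * κ) (p * γ)
  have : 0 ≤ ε * (p * γ) := by positivity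
  linarith

/-- **Absolute density from relative densities.** If `G` is an `ε`-regular 3-partite
3-complex with all relative densities exceeding `d` (with `0 < ε ≪ d`), then the absolute
density of the top level is `(1 ± 8ε)` times the product of all relative densities. -/
theorem stmt_12 (d : ℝ) (hd : 0 < d) :
    ∃ ε₀ : ℝ, 0 < ε₀ ∧ ∀ ε : ℝ, 0 < ε → ε < ε₀ →
    ∀ (V1 V2 V3 : Type) [Fintype V1] [Fintype V2] [Fintype V3]
      [DecidableEq V1] [DecidableEq V2] [DecidableEq V3]
      (G1 : Finset V1) (G2 : Finset V2) (G3 : Finset V3)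
      (G12 : Finset (V1 × V2)) (G13 : Finset (V1 × V3)) (G23 : Finset (V2 × V3))
      (G123 : Finset (V1 × V2 × V3)),
      G12 ⊆ G1 ×ˢ G2 → G13 ⊆ G1 ×ˢ G3 → G23 ⊆ G2 ×ˢ G3 →
      G123 ⊆ tri G12 G13 G23 →
      d < (G1.card : ℝ) / (Fintype.card V1 : ℝ) →
      d < (G2.card : ℝ) / (Fintype.card V2 : ℝ) →
      d < (G3.card : ℝ) / (Fintype.card V3 : ℝ) →
      d < (G12.card : ℝ) / ((G1.card : ℝ) * (G2.card : ℝ)) →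
      d < (G13.card : ℝ) / ((G1.card : ℝ) * (G3.card : ℝ)) →
      d < (G23.card : ℝ) / ((G2.card : ℝ) * (G3.card : ℝ)) →
      d < (G123.card : ℝ) / ((tri G12 G13 G23).card : ℝ) →
      bipRegular G1 G2 G12 ε → bipRegular G1 G3 G13 ε → bipRegular G2 G3 G23 ε →
      triRegular G12 G13 G23 G123 ε →
      |(G123.card : ℝ) /
            ((Fintype.card V1 : ℝ) * (Fintype.card V2 : ℝ) * (Fintype.card V3 : ℝ))
          - ((G1.card : ℝ) / (Fintype.card V1 : ℝ)) *
              ((G2.card : ℝ) / (Fintype.card V2 : ℝ)) *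
              ((G3.card : ℝ) / (Fintype.card V3 : ℝ)) *
              ((G12.card : ℝ) / ((G1.card : ℝ) * (G2.card : ℝ))) *
              ((G13.card : ℝ) / ((G1.card : ℝ) * (G3.card : ℝ))) *
              ((G23.card : ℝ) / ((G2.card : ℝ) * (G3.card : ℝ))) *
              ((G123.card : ℝ) / ((tri G12 G13 G23).card : ℝ))|
        ≤ 8 * ε *
            (((G1.card : ℝ) / (Fintype.card V1 : ℝ)) *
              ((G2.card : ℝ) / (Fintype.card V2 : ℝ)) *
              ((G3.card : ℝ) / (Fintype.card V3 : ℝ)) *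
              ((G12.card : ℝ) / ((G1.card : ℝ) * (G2.card : ℝ))) *
              ((G13.card : ℝ) / ((G1.card : ℝ) * (G3.card : ℝ))) *
              ((G23.card : ℝ) / ((G2.card : ℝ) * (G3.card : ℝ))) *
              ((G123.card : ℝ) / ((tri G12 G13 G23).card : ℝ))) := by
  obtain ⟨m, hm⟩ := exists_nat_ge (1 / d)
  have hm' : 1 ≤ d * ((m : ℝ) + 1) := by
    rw [div_le_iff₀ hd] at hm
    nlinarith
  refine ⟨min (1 / 3) (min (d ^ 2 / 100) (d ^ (2 * m + 3) / (1000 * ((m : ℝ) + 1)))),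
    by positivity, ?_⟩
  intro ε hε hεlt V1 V2 V3 _ _ _ _ _ _ G1 G2 G3 G12 G13 G23 G123 h12 h13 h23 h123
    d1 d2 d3 d12 d13 d23 d123 r12 r13 r23 _
  simp only [lt_min_iff] at hεlt
  have hne : ∀ {V : Type} [Fintype V] (G : Finset V),
      d < (G.card : ℝ) / (Fintype.card V : ℝ) → G.Nonempty ∧ (0 : ℝ) < Fintype.card V := by
    intro V _ G h
    have : G.Nonempty := by
      rcases G.eq_empty_or_nonempty with rfl | h'
      · simp at h; linarith
      · exact h'
    refine ⟨this, ?_⟩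
    have : 0 < Fintype.card V := Fintype.card_pos_iff.2 ⟨this.choose⟩
    exact_mod_cast this
  obtain ⟨n1, N1⟩ := hne G1 d1
  obtain ⟨n2, N2⟩ := hne G2 d2
  obtain ⟨n3, N3⟩ := hne G3 d3
  have key := tri_count d hd m hm' ε hε hεlt.1 hεlt.2.1 hεlt.2.2 G1 G2 G3 G12 G13 G23 h12 h13 h23
    n1 n2 n3 _ _ _ rfl rfl rfl d12 d13 d23 r12 r13 r23
  have c1 : (0 : ℝ) < G1.card := by exact_mod_cast n1.card_pos
  have c2 : (0 : ℝ) < G2.card := by exact_mod_cast n2.card_pos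
  have c3 : (0 : ℝ) < G3.card := by exact_mod_cast n3.card_pos
  have cT : ((tri G12 G13 G23).card : ℝ) ≠ 0 := by
    intro h
    rw [h, div_zero] at d123
    linarith
  generalize (G12.card : ℝ) / ((G1.card : ℝ) * (G2.card : ℝ)) = α at *
  generalize (G13.card : ℝ) / ((G1.card : ℝ) * (G3.card : ℝ)) = β at *
  generalize (G23.card : ℝ) / ((G2.card : ℝ) * (G3.card : ℝ)) = γ at *
  have e0 : (G123.card : ℝ) /
      ((Fintype.card V1 : ℝ) * (Fintype.card V2 : ℝ) * (Fintype.card V3 : ℝ))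
      = ((G1.card : ℝ) / (Fintype.card V1 : ℝ)) * ((G2.card : ℝ) / (Fintype.card V2 : ℝ)) *
          ((G3.card : ℝ) / (Fintype.card V3 : ℝ)) *
          ((G123.card : ℝ) / ((tri G12 G13 G23).card : ℝ)) *
          (((tri G12 G13 G23).card : ℝ) / ((G1.card : ℝ) * G2.card * G3.card)) := by
    field_simp
  rw [e0]
  generalize ((tri G12 G13 G23).card : ℝ) / ((G1.card : ℝ) * G2.card * G3.card) = τ at *
  have p1 := hd.trans d1
  have p2 := hd.trans d2
  have p3 := hd.trans d3
  have p4 := hd.trans d123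
  generalize (G1.card : ℝ) / (Fintype.card V1 : ℝ) = q1 at *
  generalize (G2.card : ℝ) / (Fintype.card V2 : ℝ) = q2 at *
  generalize (G3.card : ℝ) / (Fintype.card V3 : ℝ) = q3 at *
  generalize (G123.card : ℝ) / ((tri G12 G13 G23).card : ℝ) = q4 at *
  have e1 : q1 * q2 * q3 * q4 * τ - q1 * q2 * q3 * α * β * γ * q4
      = (q1 * q2 * q3 * q4) * (τ - α * β * γ) := by ring
  have hq : 0 < q1 * q2 * q3 * q4 := by positivity
  rw [e1, abs_mul, abs_of_pos hq]
  calc _ ≤ (q1 * q2 * q3 * q4) * (8 * ε * (α * β * γ)) := mul_le_mul_of_nonneg_left key hq.le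
    _ = _ := by ring
end

section
/- Suppose 0 < ε ≪ ε' ≪ d, G is an ε-regular 3-partite 3-complex on V_1 ∪ V_2 ∪ V_3 with all relative densities exceeding d. Then for all but at most ε'·|G_{12}| pairs uv ∈ G_{12}, the common-neighbourhood size satisfies |G(uv)_3| = (1 ± ε')·d_{123}(G)·d_{13}(G)·d_{23}(G)·|G_3|. -/
open Finset

lemma aux_card_edges {α β : Type} [DecidableEq α] [DecidableEq β]
    (E : Finset (α × β)) (A' : Finset α) (B' : Finset β) :
    (E.filter fun p => p.1 ∈ A' ∧ p.2 ∈ B').card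
      = ∑ a ∈ A', (B'.filter fun b => (a, b) ∈ E).card := by
  have h : (E.filter fun p => p.1 ∈ A' ∧ p.2 ∈ B') = (A' ×ˢ B').filter (fun p => p ∈ E) := by
    ext p; simp only [Finset.mem_filter, Finset.mem_product]; tauto
  rw [h, Finset.card_filter, Finset.sum_product]
  simp only [Finset.card_filter]

lemma aux_reg_sum {α β : Type} [DecidableEq α] [DecidableEq β]
    (A : Finset α) (B : Finset β) (E : Finset (α × β)) (ε : ℝ) (hε : 0 < ε)
    (h : bipRegular A B E ε) (A' : Finset α) (hA : A' ⊆ A) (B' : Finset β) (hB : B' ⊆ B)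
    (h1 : ε * (A.card : ℝ) < A'.card) (h2 : ε * (B.card : ℝ) < B'.card) :
    |(∑ a ∈ A', ((B'.filter fun b => (a, b) ∈ E).card : ℝ))
      - A'.card * ((E.card : ℝ) / ((A.card : ℝ) * (B.card : ℝ)) * B'.card)|
      ≤ A'.card * (ε * B'.card) := by
  have h3 := h A' hA B' hB h1 h2
  rw [aux_card_edges] at h3
  push_cast at h3
  have pa : (0 : ℝ) < A'.card := lt_of_le_of_lt (by positivity) h1
  have pb : (0 : ℝ) < B'.card := lt_of_le_of_lt (by positivity) h2
  generalize (E.card : ℝ) / ((A.card : ℝ) * (B.card : ℝ)) = D at *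
  generalize (∑ a ∈ A', ((B'.filter fun b => (a, b) ∈ E).card : ℝ)) = S at *
  have : S - A'.card * (D * B'.card) = (S / ((A'.card : ℝ) * B'.card) - D) * (A'.card * B'.card) := by
    field_simp
  rw [this, abs_mul, abs_of_pos (mul_pos pa pb)]
  nlinarith [mul_pos pa pb]

/-- Few vertices have an atypical degree into a large set. -/
lemma aux_deg {α β : Type} [DecidableEq α] [DecidableEq β]
    (A : Finset α) (B : Finset β) (E : Finset (α × β)) (ε : ℝ) (hε : 0 < ε)
    (h : bipRegular A B E ε) (B' : Finset β) (hB : B' ⊆ B)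
    (h2 : ε * (B.card : ℝ) < B'.card) :
    ((A.filter fun a => ¬ |((B'.filter fun b => (a, b) ∈ E).card : ℝ)
      - (E.card : ℝ) / ((A.card : ℝ) * (B.card : ℝ)) * B'.card| ≤ ε * B'.card).card : ℝ)
      ≤ 2 * ε * A.card := by
  set D := (E.card : ℝ) / ((A.card : ℝ) * (B.card : ℝ)) with hD
  set U := A.filter fun a => (D + ε) * B'.card < ((B'.filter fun b => (a, b) ∈ E).card : ℝ) with hU
  set L := A.filter fun a => ((B'.filter fun b => (a, b) ∈ E).card : ℝ) < (D - ε) * B'.card with hL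
  have hUc : (U.card : ℝ) ≤ ε * A.card := by
    by_contra hc
    push Not at hc
    have h3 := aux_reg_sum A B E ε hε h U (Finset.filter_subset _ _) B' hB hc h2
    have hne : U.Nonempty := by
      rw [← Finset.card_pos]
      have h0 : (0 : ℝ) ≤ ε * A.card := by positivity
      exact_mod_cast lt_of_le_of_lt h0 hc
    have h4 := Finset.sum_lt_sum_of_nonempty hne
      (f := fun _ => (D + ε) * (B'.card : ℝ))
      (g := fun a => ((B'.filter fun b => (a, b) ∈ E).card : ℝ))
      (fun a ha => (Finset.mem_filter.1 ha).2)
    rw [Finset.sum_const, nsmul_eq_mul] at h4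
    have := (abs_le.1 h3).2
    rw [← hD] at this
    linarith
  have hLc : (L.card : ℝ) ≤ ε * A.card := by
    by_contra hc
    push Not at hc
    have h3 := aux_reg_sum A B E ε hε h L (Finset.filter_subset _ _) B' hB hc h2
    have hne : L.Nonempty := by
      rw [← Finset.card_pos]
      have h0 : (0 : ℝ) ≤ ε * A.card := by positivity
      exact_mod_cast lt_of_le_of_lt h0 hc
    have h4 := Finset.sum_lt_sum_of_nonempty hne
      (g := fun _ => (D - ε) * (B'.card : ℝ))
      (f := fun a => ((B'.filter fun b => (a, b) ∈ E).card : ℝ))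
      (fun a ha => (Finset.mem_filter.1 ha).2)
    rw [Finset.sum_const, nsmul_eq_mul] at h4
    have := (abs_le.1 h3).1
    rw [← hD] at this
    linarith
  have hsub : (A.filter fun a => ¬ |((B'.filter fun b => (a, b) ∈ E).card : ℝ)
      - D * B'.card| ≤ ε * B'.card) ⊆ U ∪ L := by
    intro a ha
    rw [Finset.mem_filter] at ha
    obtain ⟨ha, hn⟩ := ha
    by_contra hc
    apply hn
    simp only [hU, hL, Finset.mem_union, Finset.mem_filter, ha, true_and, not_or, not_lt] at hc
    rw [abs_le]
    constructor <;> linarith [hc.1, hc.2]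
  have h5 : ((A.filter fun a => ¬ |((B'.filter fun b => (a, b) ∈ E).card : ℝ)
      - D * B'.card| ≤ ε * B'.card).card : ℝ) ≤ U.card + L.card := by
    exact_mod_cast (Finset.card_le_card hsub).trans (Finset.card_union_le _ _)
  linarith

lemma aux_fiber {V1 V2 V3 : Type} [DecidableEq V1] [DecidableEq V2] [DecidableEq V3]
    (S : Finset (V1 × V2 × V3)) (J : Finset (V1 × V2)) (G3 : Finset V3)
    (hS : ∀ t ∈ S, (t.1, t.2.1) ∈ J ∧ t.2.2 ∈ G3) :
    S.card = ∑ p ∈ J, (G3.filter fun w => (p.1, p.2, w) ∈ S).card := by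
  have e : (∑ p ∈ J, (G3.filter fun w => (p.1, p.2, w) ∈ S).card)
      = ((J ×ˢ G3).filter fun q => (q.1.1, q.1.2, q.2) ∈ S).card := by
    rw [Finset.card_filter, Finset.sum_product]
    simp only [Finset.card_filter]
  rw [e]
  apply Finset.card_bij (fun t _ => ((t.1, t.2.1), t.2.2))
  · intro t ht
    simp only [Finset.mem_filter, Finset.mem_product]
    exact ⟨hS t ht, ht⟩
  · rintro ⟨a, b, c⟩ _ ⟨a', b', c'⟩ _ h
    simp only [Prod.mk.injEq] at h ⊢
    tauto
  · rintro ⟨⟨a, b⟩, c⟩ h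
    exact ⟨(a, b, c), (Finset.mem_filter.1 h).2, rfl⟩

/-- Few pairs have an atypical codegree. -/
lemma aux_codeg {V1 V2 V3 : Type} [DecidableEq V1] [DecidableEq V2] [DecidableEq V3]
    (G1 : Finset V1) (G2 : Finset V2) (G3 : Finset V3)
    (G13 : Finset (V1 × V3)) (G23 : Finset (V2 × V3)) (ε a b : ℝ) (hε : 0 < ε)
    (hε1 : ε < 1) (hn3 : 0 < G3.card)
    (ha : a = (G13.card : ℝ) / ((G1.card : ℝ) * (G3.card : ℝ)))
    (hb : b = (G23.card : ℝ) / ((G2.card : ℝ) * (G3.card : ℝ)))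
    (ha1 : a ≤ 1) (hb0 : 0 ≤ b) (hb1 : b ≤ 1) (haε : 2 * ε < a)
    (h13 : bipRegular G1 G3 G13 ε) (h23 : bipRegular G2 G3 G23 ε) :
    (((G1 ×ˢ G2).filter fun p => ¬ |((G3.filter fun w => (p.1, w) ∈ G13 ∧ (p.2, w) ∈ G23).card : ℝ)
      - a * b * G3.card| ≤ 3 * ε * G3.card).card : ℝ) ≤ 4 * ε * (G1.card * G2.card) := by
  have pn3 : (0 : ℝ) < G3.card := by exact_mod_cast hn3
  set X := G1.filter fun u => ¬ |((G3.filter fun w => (u, w) ∈ G13).card : ℝ)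
      - a * G3.card| ≤ ε * G3.card with hX
  have hXc : (X.card : ℝ) ≤ 2 * ε * G1.card := by
    rw [hX, ha]
    exact aux_deg G1 G3 G13 ε hε h13 G3 subset_rfl (by nlinarith)
  rw [Finset.card_filter, Finset.sum_product]
  simp only [← Finset.card_filter]
  set f : V1 → ℕ := fun u => (G2.filter fun v =>
    ¬ |((G3.filter fun w => (u, w) ∈ G13 ∧ (v, w) ∈ G23).card : ℝ)
      - a * b * G3.card| ≤ 3 * ε * G3.card).card with hf
  change ((∑ u ∈ G1, f u : ℕ) : ℝ) ≤ _
  push_cast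
  have key : ∀ u ∈ G1, (f u : ℝ) ≤ (if u ∈ X then (G2.card : ℝ) else 0) + 2 * ε * G2.card := by
    intro u hu
    by_cases hux : u ∈ X
    · rw [if_pos hux]
      have : (f u : ℝ) ≤ G2.card := by exact_mod_cast Finset.card_filter_le _ _
      have : 0 ≤ 2 * ε * (G2.card : ℝ) := by positivity
      linarith
    · rw [if_neg hux, zero_add]
      have hdeg : |((G3.filter fun w => (u, w) ∈ G13).card : ℝ) - a * G3.card| ≤ ε * G3.card := by
        by_contra hc
        exact hux (Finset.mem_filter.2 ⟨hu, hc⟩)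
      set N := G3.filter fun w => (u, w) ∈ G13 with hN
      have hd := abs_le.1 hdeg
      have hle : (N.card : ℝ) ≤ G3.card := by exact_mod_cast Finset.card_filter_le _ _
      have := aux_deg G2 G3 G23 ε hε h23 N (Finset.filter_subset _ _) (by nlinarith)
      refine le_trans ?_ this
      apply Nat.cast_le.2
      apply Finset.card_le_card
      intro v hv
      rw [Finset.mem_filter] at hv ⊢
      refine ⟨hv.1, fun hc => hv.2 ?_⟩
      rw [← hb, hN, Finset.filter_filter, ← hN] at hc
      have hc := abs_le.1 hc
      have e1 : ε * (N.card : ℝ) ≤ ε * G3.card := by gcongr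
      have e2 : b * (N.card : ℝ) ≤ b * (a * G3.card + ε * G3.card) := by gcongr; linarith
      have e3 : b * (a * G3.card - ε * G3.card) ≤ b * (N.card : ℝ) := by gcongr; linarith
      have e4 : b * (ε * G3.card) ≤ 1 * (ε * G3.card) := by gcongr
      have e5 : 0 < ε * G3.card := by positivity
      rw [abs_le]
      constructor <;> linarith [hc.1, hc.2]
  refine (Finset.sum_le_sum key).trans ?_
  rw [Finset.sum_add_distrib, Finset.sum_const, nsmul_eq_mul, Finset.sum_ite_mem,
    Finset.sum_const, nsmul_eq_mul, Finset.inter_eq_right.2 (Finset.filter_subset _ _)]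
  have : (X.card : ℝ) * G2.card ≤ 2 * ε * G1.card * G2.card := by gcongr
  linarith

lemma aux_pos_of_lt_div {d x y : ℝ} (hd : 0 < d) (hy : 0 ≤ y) (h : d < x / y) :
    0 < y ∧ d * y < x := by
  have : 0 < y := by
    rcases hy.eq_or_lt with h0 | h0
    · rw [← h0, div_zero] at h; linarith
    · exact h0
  exact ⟨this, (lt_div_iff₀ this).1 h⟩

set_option maxHeartbeats 2000000

/-- **Pair neighbourhoods.** Suppose `0 < ε ≪ ε' ≪ d` and `G` is an `ε`-regular 3-partite
3-complex with all relative densities exceeding `d`. Then for all but at most `ε'|G₁₂|`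
pairs `uv ∈ G₁₂` we have `|G(uv)₃| = (1 ± ε')·d₁₂₃(G)·d₁₃(G)·d₂₃(G)·|G₃|`. -/
theorem stmt_13 (d : ℝ) (hd : 0 < d) :
    ∃ ε'₀ : ℝ, 0 < ε'₀ ∧ ∀ ε' : ℝ, 0 < ε' → ε' < ε'₀ →
    ∃ ε₀ : ℝ, 0 < ε₀ ∧ ∀ ε : ℝ, 0 < ε → ε < ε₀ →
    ∀ (V1 V2 V3 : Type) [Fintype V1] [Fintype V2] [Fintype V3]
      [DecidableEq V1] [DecidableEq V2] [DecidableEq V3]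
      (G1 : Finset V1) (G2 : Finset V2) (G3 : Finset V3)
      (G12 : Finset (V1 × V2)) (G13 : Finset (V1 × V3)) (G23 : Finset (V2 × V3))
      (G123 : Finset (V1 × V2 × V3)),
      G12 ⊆ G1 ×ˢ G2 → G13 ⊆ G1 ×ˢ G3 → G23 ⊆ G2 ×ˢ G3 →
      G123 ⊆ tri G12 G13 G23 →
      d < (G1.card : ℝ) / (Fintype.card V1 : ℝ) →
      d < (G2.card : ℝ) / (Fintype.card V2 : ℝ) →
      d < (G3.card : ℝ) / (Fintype.card V3 : ℝ) →
      d < (G12.card : ℝ) / ((G1.card : ℝ) * (G2.card : ℝ)) →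
      d < (G13.card : ℝ) / ((G1.card : ℝ) * (G3.card : ℝ)) →
      d < (G23.card : ℝ) / ((G2.card : ℝ) * (G3.card : ℝ)) →
      d < (G123.card : ℝ) / ((tri G12 G13 G23).card : ℝ) →
      bipRegular G1 G2 G12 ε → bipRegular G1 G3 G13 ε → bipRegular G2 G3 G23 ε →
      triRegular G12 G13 G23 G123 ε →
      ((G12.filter fun p =>
          ¬ |((G3.filter fun w => (p.1, p.2, w) ∈ G123).card : ℝ) -
                ((G123.card : ℝ) / ((tri G12 G13 G23).card : ℝ)) *
                  ((G13.card : ℝ) / ((G1.card : ℝ) * (G3.card : ℝ))) *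
                  ((G23.card : ℝ) / ((G2.card : ℝ) * (G3.card : ℝ))) * (G3.card : ℝ)| ≤
              ε' * (((G123.card : ℝ) / ((tri G12 G13 G23).card : ℝ)) *
                  ((G13.card : ℝ) / ((G1.card : ℝ) * (G3.card : ℝ))) *
                  ((G23.card : ℝ) / ((G2.card : ℝ) * (G3.card : ℝ))) *
                  (G3.card : ℝ))).card : ℝ)
        ≤ ε' * (G12.card : ℝ) := by
  refine ⟨1, one_pos, fun ε' he' he'1 => ⟨ε' * d ^ 3 / 100, by positivity, ?_⟩⟩
  intro ε hε hεlt V1 V2 V3 _ _ _ _ _ _ G1 G2 G3 G12 G13 G23 G123 s12 s13 s23 s123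
    _ _ _ d12 d13 d23 d123 _ r13 r23 rt
  obtain ⟨p12, q12⟩ := aux_pos_of_lt_div hd (by positivity) d12
  obtain ⟨p13, q13⟩ := aux_pos_of_lt_div hd (by positivity) d13
  obtain ⟨p23, q23⟩ := aux_pos_of_lt_div hd (by positivity) d23
  obtain ⟨pT, qT⟩ := aux_pos_of_lt_div hd (by positivity) d123
  have n1 : (0 : ℝ) < G1.card := pos_of_mul_pos_left p12 (by positivity)
  have n2 : (0 : ℝ) < G2.card := pos_of_mul_pos_right p12 (by positivity)
  have n3 : (0 : ℝ) < G3.card := pos_of_mul_pos_right p13 (by positivity)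
  have hD1 : (G123.card : ℝ) / ((tri G12 G13 G23).card : ℝ) ≤ 1 := by
    rw [div_le_one pT]; exact_mod_cast Finset.card_le_card s123
  have ha1 : (G13.card : ℝ) / ((G1.card : ℝ) * (G3.card : ℝ)) ≤ 1 := by
    rw [div_le_one p13]
    exact_mod_cast (Finset.card_le_card s13).trans_eq (Finset.card_product _ _)
  have hb1 : (G23.card : ℝ) / ((G2.card : ℝ) * (G3.card : ℝ)) ≤ 1 := by
    rw [div_le_one p23]
    exact_mod_cast (Finset.card_le_card s23).trans_eq (Finset.card_product _ _)
  set D := (G123.card : ℝ) / ((tri G12 G13 G23).card : ℝ) with hD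
  set a := (G13.card : ℝ) / ((G1.card : ℝ) * (G3.card : ℝ)) with ha
  set b := (G23.card : ℝ) / ((G2.card : ℝ) * (G3.card : ℝ)) with hb
  have hdlt : d < 1 := by linarith
  have hd2 : d ^ 2 ≤ d := by nlinarith
  have hd3 : d ^ 3 ≤ d ^ 2 := by nlinarith [sq_nonneg d]
  have hd3p : 0 < d ^ 3 := by positivity
  have hm1 : ε' * d ^ 3 ≤ d ^ 3 := by nlinarith
  have hm2 : ε' * d ^ 3 ≤ ε' * d := by nlinarith
  have hab : d ^ 2 < a * b := by nlinarith
  have hab1 : a * b ≤ 1 := mul_le_one₀ ha1 (by linarith) hb1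
  have hDab : d ^ 3 ≤ D * a * b := by
    have : d * d ^ 2 ≤ D * (a * b) := by gcongr
    nlinarith
  set n := (G3.card : ℝ) with hn
  -- triangle counts
  set T : V1 × V2 → ℝ := fun p =>
    ((G3.filter fun w => (p.1, w) ∈ G13 ∧ (p.2, w) ∈ G23).card : ℝ) with hT
  set N : V1 × V2 → ℝ := fun p => ((G3.filter fun w => (p.1, p.2, w) ∈ G123).card : ℝ) with hN
  have triT : ∀ J ⊆ G12, ((tri J G13 G23).card : ℝ) = ∑ p ∈ J, T p := by
    intro J hJ
    rw [aux_fiber (tri J G13 G23) J G3]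
    · push_cast
      refine Finset.sum_congr rfl fun p hp => ?_
      simp only [hT, tri, Finset.mem_filter, Finset.mem_univ, true_and]
      simp only [Prod.mk.eta, hp, true_and]
    · intro t ht
      simp only [tri, Finset.mem_filter, Finset.mem_univ, true_and] at ht
      exact ⟨ht.1, (Finset.mem_product.1 (s13 ht.2.1)).2⟩
  have triN : ∀ J ⊆ G12, ((G123 ∩ tri J G13 G23).card : ℝ) = ∑ p ∈ J, N p := by
    intro J hJ
    rw [aux_fiber (G123 ∩ tri J G13 G23) J G3]
    · push_cast
      refine Finset.sum_congr rfl fun p hp => ?_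
      simp only [hN]
      congr 2
      apply Finset.filter_congr
      intro w _
      rw [Finset.mem_inter]
      refine ⟨fun h => h.1, fun h => ⟨h, ?_⟩⟩
      have := s123 h
      simp only [tri, Finset.mem_filter, Finset.mem_univ, true_and] at this ⊢
      exact ⟨hp, this.2⟩
    · intro t ht
      have ht := (Finset.mem_inter.1 ht).2
      simp only [tri, Finset.mem_filter, Finset.mem_univ, true_and] at ht
      exact ⟨ht.1, (Finset.mem_product.1 (s13 ht.2.1)).2⟩
  have triTot : ((tri G12 G13 G23).card : ℝ) ≤ G1.card * G2.card * n := by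
    rw [triT G12 subset_rfl]
    have h1 : ∀ p ∈ G12, T p ≤ n := fun p _ => by
      simp only [hT, hn]; exact_mod_cast Finset.card_filter_le _ _
    refine (Finset.sum_le_sum h1).trans ?_
    rw [Finset.sum_const, nsmul_eq_mul]
    have : (G12.card : ℝ) ≤ G1.card * G2.card := by
      exact_mod_cast (Finset.card_le_card s12).trans_eq (Finset.card_product _ _)
    gcongr
  -- regularity on large typical sets of pairs
  have reg : ∀ J ⊆ G12, (∀ p ∈ J, |T p - a * b * n| ≤ 3 * ε * n) →
      ε' / 4 * G12.card < J.card →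
      0 < J.card ∧ (∑ p ∈ J, N p) ≤ J.card * ((D + ε) * (a * b * n + 3 * ε * n)) ∧
      J.card * ((D - ε) * (a * b * n - 3 * ε * n)) ≤ ∑ p ∈ J, N p := by
    intro J hJ hgood hbig
    have pJ : (0 : ℝ) < J.card := lt_of_le_of_lt (by positivity) hbig
    have hup : (∑ p ∈ J, T p) ≤ J.card * (a * b * n + 3 * ε * n) := by
      rw [← nsmul_eq_mul, ← Finset.sum_const]
      exact Finset.sum_le_sum fun p hp => by linarith [(abs_le.1 (hgood p hp)).2]
    have hlo : J.card * (a * b * n - 3 * ε * n) ≤ (∑ p ∈ J, T p) := by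
      rw [← nsmul_eq_mul, ← Finset.sum_const]
      exact Finset.sum_le_sum fun p hp => by linarith [(abs_le.1 (hgood p hp)).1]
    have hlarge : ε * ((tri G12 G13 G23).card : ℝ) < ∑ p ∈ J, T p := by
      have e1 : ε * ((tri G12 G13 G23).card : ℝ) ≤ ε * (G1.card * G2.card * n) := by gcongr
      have e2 : ε' / 4 * (d * (G1.card * G2.card)) ≤ J.card := by
        have : ε' / 4 * (d * (G1.card * G2.card)) ≤ ε' / 4 * G12.card := by gcongr
        linarith
      have e3 : d ^ 2 / 2 * n ≤ a * b * n - 3 * ε * n := by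
        have : d ^ 2 / 2 ≤ a * b - 3 * ε := by nlinarith
        nlinarith
      have e4 : ε' / 4 * (d * (G1.card * G2.card)) * (d ^ 2 / 2 * n)
          ≤ J.card * (a * b * n - 3 * ε * n) := by gcongr
      have e5 : ε * (G1.card * G2.card * n) < ε' * d ^ 3 / 100 * (G1.card * G2.card * n) := by
        gcongr
      have e6 : 0 < ε' * d ^ 3 * (G1.card * G2.card * n) := by positivity
      nlinarith
    have hr := rt J hJ G13 subset_rfl G23 subset_rfl (by rw [triT J hJ]; exact hlarge)
    rw [triT J hJ, triN J hJ, ← hD] at hr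
    have pS : 0 < ∑ p ∈ J, T p := lt_of_le_of_lt (by positivity) hlarge
    have hr := abs_le.1 hr
    have r1 : (∑ p ∈ J, N p) / (∑ p ∈ J, T p) ≤ D + ε := by linarith [hr.2]
    have r2 : D - ε ≤ (∑ p ∈ J, N p) / (∑ p ∈ J, T p) := by linarith [hr.1]
    rw [div_le_iff₀ pS] at r1
    rw [le_div_iff₀ pS] at r2
    have hDε : 0 ≤ D - ε := by nlinarith
    refine ⟨by exact_mod_cast pJ, ?_, ?_⟩
    · have : (D + ε) * (∑ p ∈ J, T p) ≤ (D + ε) * (J.card * (a * b * n + 3 * ε * n)) := by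
        gcongr
      linarith
    · have : (D - ε) * (J.card * (a * b * n - 3 * ε * n)) ≤ (D - ε) * (∑ p ∈ J, T p) := by
        gcongr
      linarith
  have hmain : ε' * (d ^ 3 * n) ≤ ε' * (D * a * b * n) := by gcongr
  have h100 : 100 * ε * n ≤ ε' * (d ^ 3 * n) := by nlinarith
  have hεn : 0 < ε * n := by positivity
  have f1 : ε * (a * b * n) ≤ ε * n := by nlinarith
  have f2 : D * (3 * ε * n) ≤ 3 * (ε * n) := by nlinarith
  have hε1 : ε < 1 := by nlinarith
  have f3 : ε * (3 * ε * n) ≤ 3 * (ε * n) := by nlinarith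
  set bad := G12.filter fun p => ¬ |T p - a * b * n| ≤ 3 * ε * n with hbad
  set U := G12.filter fun p => |T p - a * b * n| ≤ 3 * ε * n ∧
    (1 + ε') * (D * a * b * n) < N p with hU
  set L := G12.filter fun p => |T p - a * b * n| ≤ 3 * ε * n ∧
    N p < (1 - ε') * (D * a * b * n) with hL
  have cbad : (bad.card : ℝ) ≤ ε' / 4 * G12.card := by
    have h1 := aux_codeg G1 G2 G3 G13 G23 ε a b hε hε1 (Nat.cast_pos.1 n3) ha hb ha1
      (by linarith) hb1 (by nlinarith) r13 r23
    have h2 : (bad.card : ℝ) ≤ 4 * ε * (G1.card * G2.card) := by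
      refine le_trans ?_ h1
      exact_mod_cast Finset.card_le_card (Finset.filter_subset_filter _ s12)
    have h3 : 4 * ε ≤ ε' / 4 * d := by nlinarith
    have h4 : 4 * ε * (G1.card * G2.card) ≤ ε' / 4 * d * (G1.card * G2.card) := by gcongr
    have h5 : ε' / 4 * (d * (G1.card * G2.card)) ≤ ε' / 4 * G12.card := by gcongr
    linarith
  have cU : (U.card : ℝ) ≤ ε' / 4 * G12.card := by
    by_contra hc
    push Not at hc
    obtain ⟨h0, h1, _⟩ := reg U (Finset.filter_subset _ _)
      (fun p hp => (Finset.mem_filter.1 hp).2.1) hc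
    have h2 : U.card * ((1 + ε') * (D * a * b * n)) < ∑ p ∈ U, N p := by
      rw [← nsmul_eq_mul, ← Finset.sum_const]
      exact Finset.sum_lt_sum_of_nonempty (Finset.card_pos.1 h0)
        fun p hp => (Finset.mem_filter.1 hp).2.2
    have h3 := lt_of_mul_lt_mul_left (h2.trans_le h1) (by positivity)
    linarith
  have cL : (L.card : ℝ) ≤ ε' / 4 * G12.card := by
    by_contra hc
    push Not at hc
    obtain ⟨h0, _, h1⟩ := reg L (Finset.filter_subset _ _)
      (fun p hp => (Finset.mem_filter.1 hp).2.1) hc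
    have h2 : ∑ p ∈ L, N p < L.card * ((1 - ε') * (D * a * b * n)) := by
      rw [← nsmul_eq_mul, ← Finset.sum_const]
      exact Finset.sum_lt_sum_of_nonempty (Finset.card_pos.1 h0)
        fun p hp => (Finset.mem_filter.1 hp).2.2
    have h3 := lt_of_mul_lt_mul_left (h1.trans_lt h2) (by positivity)
    have : 0 < ε * (3 * ε * n) := by positivity
    linarith
  have hsub : (G12.filter fun p => ¬ |N p - D * a * b * n| ≤ ε' * (D * a * b * n))
      ⊆ bad ∪ (U ∪ L) := by
    intro p hp
    rw [Finset.mem_filter] at hp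
    obtain ⟨hp, hne⟩ := hp
    by_contra hc
    apply hne
    simp only [hbad, hU, hL, Finset.mem_union, Finset.mem_filter, hp, true_and, not_or,
      not_not, not_and, not_lt] at hc
    obtain ⟨h1, h2, h3⟩ := hc
    have h2 := h2 h1
    have h3 := h3 h1
    rw [abs_le]
    constructor <;> linarith
  have hfin : ((G12.filter fun p => ¬ |N p - D * a * b * n| ≤ ε' * (D * a * b * n)).card : ℝ)
      ≤ bad.card + (U.card + L.card) := by
    have := (Finset.card_le_card hsub).trans ((Finset.card_union_le _ _).trans
      (Nat.add_le_add_left (Finset.card_union_le _ _) _))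
    exact_mod_cast this
  have : 0 ≤ ε' * (G12.card : ℝ) := by positivity
  refine hfin.trans ?_
  linarith
end

section
/- Suppose 0 < ε ≪ ε' ≪ d, G is an ε-regular 3-partite 3-complex on V_1 ∪ V_2 ∪ V_3 with all relative densities exceeding d. Then: (i) for all but at most ε'|G_1| vertices v ∈ G_1 we have |G(v)_{23}| = (1 ± ε')·|G_{123}|/|G_1|; and (ii) for all but at most ε'|G_{12}| pairs uv ∈ G_{12} we have |G(uv)_3| = (1 ± ε')·|G_{123}|/|G_{12}|. -/
open Finset

lemma disc_of_bip {α β : Type} [DecidableEq α] [DecidableEq β]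
    (A : Finset α) (B : Finset β) (E : Finset (α × β)) (ε δ : ℝ) (hε : 0 < ε)
    (hδ : δ = (E.card : ℝ) / ((A.card : ℝ) * (B.card : ℝ)))
    (hδ0 : 0 ≤ δ) (hδ1 : δ ≤ 1)
    (h : bipRegular A B E ε) (A' : Finset α) (hA : A' ⊆ A) (B' : Finset β) (hB : B' ⊆ B) :
    |∑ a ∈ A', ∑ b ∈ B', ((if (a, b) ∈ E then (1:ℝ) else 0) - δ)| ≤ ε * (A.card * B.card) := by
  have hcard : (∑ a ∈ A', ∑ b ∈ B', (if (a, b) ∈ E then (1:ℝ) else 0))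
      = ((E.filter fun p => p.1 ∈ A' ∧ p.2 ∈ B').card : ℝ) := by
    rw [← Finset.sum_product', Finset.sum_boole]
    congr 2
    ext p
    simp only [Finset.mem_filter, Finset.mem_product]
    tauto
  have hsum : ∑ a ∈ A', ∑ b ∈ B', ((if (a, b) ∈ E then (1:ℝ) else 0) - δ)
      = ((E.filter fun p => p.1 ∈ A' ∧ p.2 ∈ B').card : ℝ) - δ * (A'.card * B'.card) := by
    simp only [Finset.sum_sub_distrib]
    rw [hcard]
    simp
    ring
  rw [hsum]
  have hle : ((E.filter fun p => p.1 ∈ A' ∧ p.2 ∈ B').card : ℝ) ≤ A'.card * B'.card := by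
    rw [← Nat.cast_mul, ← Finset.card_product]
    exact_mod_cast Finset.card_le_card (fun p hp => by
      simp only [Finset.mem_filter] at hp
      exact Finset.mem_product.2 hp.2)
  have hA' : (A'.card : ℝ) ≤ A.card := by exact_mod_cast Finset.card_le_card hA
  have hB' : (B'.card : ℝ) ≤ B.card := by exact_mod_cast Finset.card_le_card hB
  have hx0 : (0:ℝ) ≤ ((E.filter fun p => p.1 ∈ A' ∧ p.2 ∈ B').card : ℝ) := Nat.cast_nonneg _
  have ha0 : (0:ℝ) ≤ A'.card := Nat.cast_nonneg _
  have hb0 : (0:ℝ) ≤ B'.card := Nat.cast_nonneg _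
  have hA0 : (0:ℝ) ≤ A.card := Nat.cast_nonneg _
  have hB0 : (0:ℝ) ≤ B.card := Nat.cast_nonneg _
  have hkey := h A' hA B' hB
  rw [← hδ] at hkey
  generalize ((E.filter fun p => p.1 ∈ A' ∧ p.2 ∈ B').card : ℝ) = x at *
  generalize (A'.card : ℝ) = a at *
  generalize (B'.card : ℝ) = b at *
  generalize (A.card : ℝ) = m at *
  generalize (B.card : ℝ) = n at *
  have hab : 0 ≤ a * b := mul_nonneg ha0 hb0
  have hsmall : a * b ≤ ε * (m * n) → |x - δ * (a * b)| ≤ ε * (m * n) := by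
    intro hs
    have : δ * (a * b) ≤ a * b := by nlinarith
    have : 0 ≤ δ * (a * b) := mul_nonneg hδ0 hab
    rw [abs_le]; constructor <;> linarith
  by_cases h1 : ε * m < a
  · by_cases h2 : ε * n < b
    · have hk := hkey h1 h2
      have hap : 0 < a := lt_of_le_of_lt (by positivity) h1
      have hbp : 0 < b := lt_of_le_of_lt (by positivity) h2
      have hpos : 0 < a * b := mul_pos hap hbp
      have : x - δ * (a * b) = (x / (a * b) - δ) * (a * b) := by field_simp
      rw [this, abs_mul, abs_of_pos hpos]
      have h3 : a * b ≤ m * n := mul_le_mul hA' hB' hb0 hA0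
      calc _ ≤ ε * (a * b) := by gcongr
        _ ≤ _ := by gcongr
    · apply hsmall
      calc a * b ≤ m * (ε * n) := mul_le_mul hA' (not_lt.1 h2) hb0 hA0
        _ = _ := by ring
  · apply hsmall
    calc a * b ≤ (ε * m) * n := mul_le_mul (not_lt.1 h1) hB' hb0 (by positivity)
      _ = _ := by ring

lemma sum_pairs {α β : Type} [DecidableEq α] [DecidableEq β]
    (A : Finset α) (B : Finset β) (E : Finset (α × β)) (hE : E ⊆ A ×ˢ B) (f : α → β → ℝ) :
    ∑ p ∈ E, f p.1 p.2 = ∑ a ∈ A, ∑ b ∈ B with (a, b) ∈ E, f a b := by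
  have : E = (A ×ˢ B).filter (fun p => p ∈ E) := by
    rw [Finset.filter_mem_eq_inter, Finset.inter_eq_right.2 hE]
  conv_lhs => rw [this]
  rw [Finset.sum_filter, Finset.sum_product]
  simp only [Finset.sum_filter]

lemma sum_pairs' {α β : Type} [DecidableEq α] [DecidableEq β]
    (A : Finset α) (B : Finset β) (E : Finset (α × β)) (hE : E ⊆ A ×ˢ B) (f : α → β → ℝ) :
    ∑ p ∈ E, f p.1 p.2 = ∑ b ∈ B, ∑ a ∈ A with (a, b) ∈ E, f a b := by
  rw [sum_pairs A B E hE]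
  simp only [Finset.sum_filter]
  rw [Finset.sum_comm]

lemma tri_card {V1 V2 V3 : Type} [Fintype V1] [Fintype V2] [Fintype V3]
    [DecidableEq V1] [DecidableEq V2] [DecidableEq V3] (G3 : Finset V3)
    (B : Finset (V1 × V2)) (G13 : Finset (V1 × V3)) (G23 : Finset (V2 × V3))
    (G : Finset (V1 × V2 × V3)) (hG : ∀ t ∈ G, t.2.2 ∈ G3 ∧ (t.1, t.2.1) ∈ B) :
    (G.card : ℝ) = ∑ p ∈ B, ((G3.filter fun w => (p.1, p.2, w) ∈ G).card : ℝ) := by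
  rw [← Nat.cast_sum]
  congr 1
  rw [Finset.card_eq_sum_card_fiberwise (f := fun t : V1 × V2 × V3 => (t.1, t.2.1)) (t := B)
    (fun t ht => (hG t ht).2)]
  refine Finset.sum_congr rfl fun p _ => ?_
  refine Finset.card_bij (fun t _ => t.2.2) ?_ ?_ ?_
  · rintro ⟨a, b, c⟩ h
    simp only [Finset.mem_filter] at h ⊢
    obtain ⟨h1, rfl⟩ := h
    exact ⟨(hG _ h1).1, h1⟩
  · rintro ⟨a, b, c⟩ h ⟨a', b', c'⟩ h' hc
    simp only [Finset.mem_filter] at h h' hc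
    obtain ⟨_, rfl⟩ := h
    obtain ⟨_, h2⟩ := h'
    simp only [Prod.mk.injEq] at h2 ⊢
    exact ⟨h2.1.symm, h2.2.symm, hc⟩
  · intro w hw
    simp only [Finset.mem_filter] at hw
    exact ⟨(p.1, p.2, w), by simp [hw.2], rfl⟩

lemma tri_count_s14 {V1 V2 V3 : Type} [Fintype V1] [Fintype V2] [Fintype V3]
    [DecidableEq V1] [DecidableEq V2] [DecidableEq V3]
    (G1 : Finset V1) (G2 : Finset V2) (G3 : Finset V3)
    (G13 : Finset (V1 × V3)) (G23 : Finset (V2 × V3))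
    (h13 : G13 ⊆ G1 ×ˢ G3) (ε x y : ℝ) (hx0 : 0 ≤ x) (hx1 : x ≤ 1)
    (H13 : ∀ A' ⊆ G1, ∀ B' ⊆ G3,
      |∑ a ∈ A', ∑ b ∈ B', ((if (a, b) ∈ G13 then (1:ℝ) else 0) - x)| ≤ ε * (G1.card * G3.card))
    (H23 : ∀ A' ⊆ G2, ∀ B' ⊆ G3,
      |∑ a ∈ A', ∑ b ∈ B', ((if (a, b) ∈ G23 then (1:ℝ) else 0) - y)| ≤ ε * (G2.card * G3.card))
    (B : Finset (V1 × V2)) (hB : B ⊆ G1 ×ˢ G2) :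
    |((tri B G13 G23).card : ℝ) - x * y * G3.card * B.card|
      ≤ 2 * ε * (G1.card * G2.card * G3.card) := by
  have e1 : ((tri B G13 G23).card : ℝ) = ∑ p ∈ B, ∑ w ∈ G3,
      (if (p.1, w) ∈ G13 then (1:ℝ) else 0) * (if (p.2, w) ∈ G23 then (1:ℝ) else 0) := by
    rw [tri_card G3 B G13 G23]
    · refine Finset.sum_congr rfl fun p hp => ?_
      rw [← Finset.sum_boole]
      refine Finset.sum_congr rfl fun w _ => ?_
      simp only [tri, Finset.mem_filter, Finset.mem_univ, true_and, hp, Prod.mk.eta]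
      by_cases h1 : (p.1, w) ∈ G13 <;> by_cases h2 : (p.2, w) ∈ G23 <;> simp [h1, h2]
    · intro t ht
      simp only [tri, Finset.mem_filter, Finset.mem_univ, true_and] at ht
      exact ⟨(Finset.mem_product.1 (h13 ht.2.1)).2, ht.1⟩
  have e2 : ((tri B G13 G23).card : ℝ) - x * y * G3.card * B.card =
      (∑ p ∈ B, ∑ w ∈ G3 with (p.2, w) ∈ G23, ((if (p.1, w) ∈ G13 then (1:ℝ) else 0) - x))
      + x * ∑ p ∈ B, ∑ w ∈ G3, ((if (p.2, w) ∈ G23 then (1:ℝ) else 0) - y) := by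
    have : x * y * (G3.card : ℝ) * B.card = ∑ p ∈ B, ∑ w ∈ G3, x * y := by
      simp; ring
    rw [e1, this, Finset.mul_sum, ← Finset.sum_add_distrib, ← Finset.sum_sub_distrib]
    refine Finset.sum_congr rfl fun p _ => ?_
    rw [Finset.sum_filter, Finset.mul_sum, ← Finset.sum_add_distrib, ← Finset.sum_sub_distrib]
    refine Finset.sum_congr rfl fun w _ => ?_
    split_ifs <;> ring
  rw [e2]
  have b1 : |∑ p ∈ B, ∑ w ∈ G3 with (p.2, w) ∈ G23, ((if (p.1, w) ∈ G13 then (1:ℝ) else 0) - x)|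
      ≤ ε * (G1.card * G2.card * G3.card) := by
    rw [sum_pairs' G1 G2 B hB
      (fun u v => ∑ w ∈ G3 with (v, w) ∈ G23, ((if (u, w) ∈ G13 then (1:ℝ) else 0) - x))]
    refine (Finset.abs_sum_le_sum_abs _ _).trans ?_
    refine (Finset.sum_le_sum fun v _ =>
      H13 _ (Finset.filter_subset _ _) _ (Finset.filter_subset _ _)).trans ?_
    simp only [Finset.sum_const, nsmul_eq_mul]
    apply le_of_eq; ring
  have b2 : |∑ p ∈ B, ∑ w ∈ G3, ((if (p.2, w) ∈ G23 then (1:ℝ) else 0) - y)|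
      ≤ ε * (G1.card * G2.card * G3.card) := by
    rw [sum_pairs G1 G2 B hB
      (fun u v => ∑ w ∈ G3, ((if (v, w) ∈ G23 then (1:ℝ) else 0) - y))]
    refine (Finset.abs_sum_le_sum_abs _ _).trans ?_
    refine (Finset.sum_le_sum fun v _ =>
      H23 _ (Finset.filter_subset _ _) _ (Finset.Subset.refl _)).trans ?_
    simp only [Finset.sum_const, nsmul_eq_mul]
    apply le_of_eq; ring
  refine (abs_add_le _ _).trans ?_
  rw [abs_mul, abs_of_nonneg hx0]
  have := mul_le_mul hx1 b2 (abs_nonneg _) zero_le_one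
  linarith

lemma bad_small {α : Type} [DecidableEq α] (S : Finset α) (f : α → ℝ) (M K e : ℝ)
    (hS : 0 < (S.card : ℝ)) (hM : 0 < M) (he : 0 < e)
    (hK : 2 * K ≤ e ^ 2 * M)
    (h : ∀ A ⊆ S, |∑ a ∈ A, f a - M * A.card / S.card| ≤ K) :
    ((S.filter fun v => ¬ |f v - M / S.card| ≤ e * (M / S.card)).card : ℝ) ≤ e * S.card := by
  set m := M / (S.card : ℝ) with hm
  have hm0 : 0 < m := div_pos hM hS
  have hMm : m * S.card = M := div_mul_cancel₀ _ hS.ne'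
  have hsub : (S.filter fun v => ¬ |f v - m| ≤ e * m) ⊆
      (S.filter fun v => e * m ≤ f v - m) ∪ (S.filter fun v => e * m ≤ m - f v) := by
    intro v hv
    simp only [Finset.mem_filter, Finset.mem_union, not_le] at hv ⊢
    rcases lt_abs.1 hv.2 with h1 | h1
    · exact Or.inl ⟨hv.1, h1.le⟩
    · exact Or.inr ⟨hv.1, by linarith⟩
  have hcard := (Finset.card_le_card hsub).trans (Finset.card_union_le _ _)
  have hcard' : ((S.filter fun v => ¬ |f v - m| ≤ e * m).card : ℝ) ≤
      ((S.filter fun v => e * m ≤ f v - m).card : ℝ)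
        + ((S.filter fun v => e * m ≤ m - f v).card : ℝ) := by exact_mod_cast hcard
  have fin : ∀ c : ℝ, c * (e * m) ≤ K → c ≤ e * S.card / 2 := by
    intro c hc
    have h1 : (2 * c) * (e * m) ≤ (e * S.card) * (e * m) := by rw [← hMm] at hK; nlinarith
    have := le_of_mul_le_mul_right h1 (by positivity)
    linarith
  have a1 := fin ((S.filter fun v => e * m ≤ f v - m).card : ℝ) (by
    have h1 := (abs_le.1 (h (S.filter fun v => e * m ≤ f v - m) (Finset.filter_subset _ _))).2
    have h2 : ∑ a ∈ S.filter (fun v => e * m ≤ f v - m), (e * m) ≤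
        ∑ a ∈ S.filter (fun v => e * m ≤ f v - m), (f a - m) :=
      Finset.sum_le_sum fun a ha => (Finset.mem_filter.1 ha).2
    simp only [Finset.sum_sub_distrib, Finset.sum_const, nsmul_eq_mul] at h2
    rw [mul_div_right_comm, ← hm] at h1
    linarith)
  have a2 := fin ((S.filter fun v => e * m ≤ m - f v).card : ℝ) (by
    have h1 := (abs_le.1 (h (S.filter fun v => e * m ≤ m - f v) (Finset.filter_subset _ _))).1
    have h2 : ∑ a ∈ S.filter (fun v => e * m ≤ m - f v), (e * m) ≤
        ∑ a ∈ S.filter (fun v => e * m ≤ m - f v), (m - f a) :=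
      Finset.sum_le_sum fun a ha => (Finset.mem_filter.1 ha).2
    simp only [Finset.sum_sub_distrib, Finset.sum_const, nsmul_eq_mul] at h2
    rw [mul_div_right_comm, ← hm] at h1
    linarith)
  linarith

lemma dens_le_one {α β : Type} [DecidableEq α] [DecidableEq β]
    (A : Finset α) (B : Finset β) (E : Finset (α × β)) (hE : E ⊆ A ×ˢ B) :
    (E.card : ℝ) / ((A.card : ℝ) * (B.card : ℝ)) ≤ 1 := by
  apply div_le_one_of_le₀ _ (by positivity)
  rw [← Nat.cast_mul, ← Finset.card_product]
  exact_mod_cast Finset.card_le_card hE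

set_option maxHeartbeats 4000000

/-- **Averaging.** Suppose `0 < ε ≪ ε' ≪ d` and `G` is an `ε`-regular 3-partite 3-complex
with all relative densities exceeding `d`. Then (i) for all but at most `ε'|G₁|` vertices
`v ∈ G₁` we have `|G(v)₂₃| = (1 ± ε')·|G₁₂₃|/|G₁|`, and (ii) for all but at most
`ε'|G₁₂|` pairs `uv ∈ G₁₂` we have `|G(uv)₃| = (1 ± ε')·|G₁₂₃|/|G₁₂|`. -/
theorem stmt_14 (d : ℝ) (hd : 0 < d) :
    ∃ ε'₀ : ℝ, 0 < ε'₀ ∧ ∀ ε' : ℝ, 0 < ε' → ε' < ε'₀ →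
    ∃ ε₀ : ℝ, 0 < ε₀ ∧ ∀ ε : ℝ, 0 < ε → ε < ε₀ →
    ∀ (V1 V2 V3 : Type) [Fintype V1] [Fintype V2] [Fintype V3]
      [DecidableEq V1] [DecidableEq V2] [DecidableEq V3]
      (G1 : Finset V1) (G2 : Finset V2) (G3 : Finset V3)
      (G12 : Finset (V1 × V2)) (G13 : Finset (V1 × V3)) (G23 : Finset (V2 × V3))
      (G123 : Finset (V1 × V2 × V3)),
      G12 ⊆ G1 ×ˢ G2 → G13 ⊆ G1 ×ˢ G3 → G23 ⊆ G2 ×ˢ G3 →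
      G123 ⊆ tri G12 G13 G23 →
      d < (G1.card : ℝ) / (Fintype.card V1 : ℝ) →
      d < (G2.card : ℝ) / (Fintype.card V2 : ℝ) →
      d < (G3.card : ℝ) / (Fintype.card V3 : ℝ) →
      d < (G12.card : ℝ) / ((G1.card : ℝ) * (G2.card : ℝ)) →
      d < (G13.card : ℝ) / ((G1.card : ℝ) * (G3.card : ℝ)) →
      d < (G23.card : ℝ) / ((G2.card : ℝ) * (G3.card : ℝ)) →
      d < (G123.card : ℝ) / ((tri G12 G13 G23).card : ℝ) →
      bipRegular G1 G2 G12 ε → bipRegular G1 G3 G13 ε → bipRegular G2 G3 G23 ε →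
      triRegular G12 G13 G23 G123 ε →
      (((G1.filter fun v =>
          ¬ |((G23.filter fun q => (v, q) ∈ G123).card : ℝ) -
                (G123.card : ℝ) / (G1.card : ℝ)| ≤
              ε' * ((G123.card : ℝ) / (G1.card : ℝ))).card : ℝ)
        ≤ ε' * (G1.card : ℝ)) ∧
      (((G12.filter fun p =>
          ¬ |((G3.filter fun w => (p.1, p.2, w) ∈ G123).card : ℝ) -
                (G123.card : ℝ) / (G12.card : ℝ)| ≤
              ε' * ((G123.card : ℝ) / (G12.card : ℝ))).card : ℝ)
        ≤ ε' * (G12.card : ℝ)) := by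
  refine ⟨1, one_pos, fun e he _ => ⟨min (d ^ 3 / 4) (e ^ 2 * d ^ 4 / 28), by positivity, ?_⟩⟩
  intro ε hε hε0 V1 V2 V3 _ _ _ _ _ _ G1 G2 G3 G12 G13 G23 G123 h12 h13 h23 h123
    _ _ _ d12 d13 d23 d123 r12 r13 r23 r123
  have hεa : ε < d ^ 3 / 4 := lt_of_lt_of_le hε0 (min_le_left _ _)
  have hεb : ε < e ^ 2 * d ^ 4 / 28 := lt_of_lt_of_le hε0 (min_le_right _ _)
  have D12 := disc_of_bip G1 G2 G12 ε _ hε rfl (hd.trans d12).le (dens_le_one _ _ _ h12) r12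
  have D13 := disc_of_bip G1 G3 G13 ε _ hε rfl (hd.trans d13).le (dens_le_one _ _ _ h13) r13
  have D23 := disc_of_bip G2 G3 G23 ε _ hε rfl (hd.trans d23).le (dens_le_one _ _ _ h23) r23
  have x1 := dens_le_one _ _ _ h13
  have y1 := dens_le_one _ _ _ h23
  have z1 := dens_le_one _ _ _ h12
  have C := tri_count_s14 G1 G2 G3 G13 G23 h13 ε _ _ (hd.trans d13).le x1
    (fun A hA B hB => D13 A hA B hB) (fun A hA B hB => D23 A hA B hB)
  have n1 : (0:ℝ) < G1.card := by
    rcases Nat.eq_zero_or_pos G1.card with h | h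
    · simp [h] at d12; linarith
    · exact_mod_cast h
  have n2 : (0:ℝ) < G2.card := by
    rcases Nat.eq_zero_or_pos G2.card with h | h
    · simp [h] at d12; linarith
    · exact_mod_cast h
  have n3 : (0:ℝ) < G3.card := by
    rcases Nat.eq_zero_or_pos G3.card with h | h
    · simp [h] at d13; linarith
    · exact_mod_cast h
  have n12 : (0:ℝ) < G12.card := by
    rcases Nat.eq_zero_or_pos G12.card with h | h
    · simp [h] at d12; linarith
    · exact_mod_cast h
  have nT : (0:ℝ) < (tri G12 G13 G23).card := by
    rcases Nat.eq_zero_or_pos (tri G12 G13 G23).card with h | h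
    · simp [h] at d123; linarith
    · exact_mod_cast h
  set x := (G13.card : ℝ) / ((G1.card : ℝ) * (G3.card : ℝ)) with hx
  set y := (G23.card : ℝ) / ((G2.card : ℝ) * (G3.card : ℝ)) with hy
  set z := (G12.card : ℝ) / ((G1.card : ℝ) * (G2.card : ℝ)) with hz
  set q := (G123.card : ℝ) / ((tri G12 G13 G23).card : ℝ) with hq
  set N := (G1.card : ℝ) * G2.card * G3.card with hN
  have N0 : 0 < N := by positivity
  have hG12 : z * (G1.card * G2.card) = (G12.card : ℝ) := div_mul_cancel₀ _ (by positivity)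
  have hM : q * (tri G12 G13 G23).card = (G123.card : ℝ) := div_mul_cancel₀ _ nT.ne'
  have q1 : q ≤ 1 := div_le_one_of_le₀ (by exact_mod_cast Finset.card_le_card h123) nT.le
  have mem3 : ∀ t ∈ G123, t.2.2 ∈ G3 ∧ (t.1, t.2.1) ∈ G12 := by
    intro t ht
    have := h123 ht
    simp only [tri, Finset.mem_filter, Finset.mem_univ, true_and] at this
    exact ⟨(Finset.mem_product.1 (h13 this.2.1)).2, this.1⟩
  -- codegrees
  set f : V1 × V2 → ℝ := fun p => ((G3.filter fun w => (p.1, p.2, w) ∈ G123).card : ℝ) with hf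
  have Msum : (G123.card : ℝ) = ∑ p ∈ G12, f p := tri_card G3 G12 G13 G23 G123 mem3
  have MleN : (G123.card : ℝ) ≤ G3.card * G12.card := by
    rw [Msum]
    calc _ ≤ ∑ p ∈ G12, (G3.card : ℝ) := Finset.sum_le_sum fun p _ => by
          exact Nat.cast_le.2 (Finset.card_le_card (Finset.filter_subset _ _))
      _ = _ := by simp; ring
  have TleN : ((tri G12 G13 G23).card : ℝ) ≤ N := by
    have h : (tri G12 G13 G23) ⊆ G1 ×ˢ G2 ×ˢ G3 := by
      intro t ht
      simp only [tri, Finset.mem_filter, Finset.mem_univ, true_and] at ht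
      have a := Finset.mem_product.1 (h12 ht.1)
      have b := Finset.mem_product.1 (h23 ht.2.2)
      exact Finset.mem_product.2 ⟨a.1, Finset.mem_product.2 b⟩
    have := Finset.card_le_card h
    rw [Finset.card_product, Finset.card_product] at this
    rw [hN, mul_assoc]
    exact_mod_cast this
  have fsum : ∀ B ⊆ G12, ((G123 ∩ tri B G13 G23).card : ℝ) = ∑ p ∈ B, f p := by
    intro B hB
    rw [tri_card G3 B G13 G23]
    · refine Finset.sum_congr rfl fun p hp => ?_
      rw [hf]
      congr 2
      ext w
      simp only [Finset.mem_filter, Finset.mem_inter]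
      constructor
      · exact fun h => ⟨h.1, h.2.1⟩
      · intro h
        refine ⟨h.1, h.2, ?_⟩
        have := h123 h.2
        simp only [tri, Finset.mem_filter, Finset.mem_univ, true_and] at this ⊢
        exact ⟨hp, this.2⟩
    · intro t ht
      have h := Finset.mem_inter.1 ht
      refine ⟨(mem3 t h.1).1, ?_⟩
      have := h.2
      simp only [tri, Finset.mem_filter, Finset.mem_univ, true_and] at this
      exact this.1
  have R : ∀ B ⊆ G12, |∑ p ∈ B, f p - q * (tri B G13 G23).card| ≤ ε * N := by
    intro B hB
    rw [← fsum B hB]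
    have hk := r123 B hB G13 (Finset.Subset.refl _) G23 (Finset.Subset.refl _)
    rw [← hq] at hk
    have hle : ((G123 ∩ tri B G13 G23).card : ℝ) ≤ (tri B G13 G23).card := by
      exact_mod_cast Finset.card_le_card Finset.inter_subset_right
    have hTB : ((tri B G13 G23).card : ℝ) ≤ (tri G12 G13 G23).card := by
      refine Nat.cast_le.2 (Finset.card_le_card ?_)
      intro t ht
      simp only [tri, Finset.mem_filter, Finset.mem_univ, true_and] at ht ⊢
      exact ⟨hB ht.1, ht.2⟩
    have s0 : (0:ℝ) ≤ (G123 ∩ tri B G13 G23).card := Nat.cast_nonneg _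
    have t0 : (0:ℝ) ≤ (tri B G13 G23).card := Nat.cast_nonneg _
    have q0 : 0 ≤ q := (hd.trans d123).le
    have εT : ε * (tri G12 G13 G23).card ≤ ε * N := by gcongr
    generalize ((G123 ∩ tri B G13 G23).card : ℝ) = s at *
    generalize ((tri B G13 G23).card : ℝ) = t at *
    by_cases hc : ε * (tri G12 G13 G23).card < t
    · have hk := hk hc
      have tp : 0 < t := lt_of_le_of_lt (by positivity) hc
      have : s - q * t = (s / t - q) * t := by field_simp
      rw [this, abs_mul, abs_of_pos tp]
      calc _ ≤ ε * t := by gcongr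
        _ ≤ ε * N := by gcongr; linarith
    · have : q * t ≤ t := by nlinarith
      have : 0 ≤ q * t := mul_nonneg q0 t0
      rw [abs_le]; constructor <;> linarith
  have P : ∀ B ⊆ G12, |∑ p ∈ B, f p - q * (x * y * G3.card * B.card)| ≤ 3 * ε * N := by
    intro B hB
    have c := C B (hB.trans h12)
    have r := R B hB
    have e1 : ∑ p ∈ B, f p - q * (x * y * G3.card * B.card) =
      (∑ p ∈ B, f p - q * (tri B G13 G23).card) +
        q * ((tri B G13 G23).card - x * y * G3.card * B.card) := by ring
    rw [e1]
    refine (abs_add_le _ _).trans ?_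
    rw [abs_mul, abs_of_nonneg (hd.trans d123).le]
    have := mul_le_mul q1 c (abs_nonneg _) zero_le_one
    linarith
  have P' : ∀ B ⊆ G12, |∑ p ∈ B, f p - G123.card * B.card / G12.card| ≤ 6 * ε * N := by
    intro B hB
    have p1 := P B hB
    have p2 := P G12 (Finset.Subset.refl _)
    rw [← Msum] at p2
    have hr0 : (0:ℝ) ≤ B.card / G12.card := by positivity
    have hr1 : (B.card : ℝ) / G12.card ≤ 1 :=
      div_le_one_of_le₀ (by exact_mod_cast Finset.card_le_card hB) n12.le
    have e1 : ∑ p ∈ B, f p - G123.card * B.card / G12.card =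
      (∑ p ∈ B, f p - q * (x * y * G3.card * B.card)) -
        (B.card / G12.card : ℝ) * (G123.card - q * (x * y * G3.card * G12.card)) := by
      field_simp
      ring
    rw [e1]
    refine (abs_sub _ _).trans ?_
    rw [abs_mul, abs_of_nonneg hr0]
    have := mul_le_mul hr1 p2 (abs_nonneg _) zero_le_one
    linarith
  have Mlow : d ^ 4 / 2 * N ≤ G123.card := by
    have c := (abs_le.1 (C G12 h12)).1
    have h1 : d ^ 3 * N ≤ x * y * G3.card * G12.card := by
      have : x * y * G3.card * G12.card = x * y * z * N := by rw [← hG12, hN]; ring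
      rw [this]
      refine mul_le_mul_of_nonneg_right ?_ N0.le
      have : d * d * d ≤ x * y * z :=
        mul_le_mul (mul_le_mul d13.le d23.le hd.le (hd.trans d13).le) d12.le hd.le
          (mul_nonneg (hd.trans d13).le (hd.trans d23).le)
      linarith [show d ^ 3 = d * d * d by ring]
    have h2 : ε * N ≤ d ^ 3 / 4 * N := mul_le_mul_of_nonneg_right hεa.le N0.le
    have h3 : d ^ 3 / 2 * N ≤ (tri G12 G13 G23).card := by linarith
    rw [← hM]
    calc d ^ 4 / 2 * N = d * (d ^ 3 / 2 * N) := by ring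
      _ ≤ _ := mul_le_mul d123.le h3 (by positivity) (hd.trans d123).le
  have M0 : (0:ℝ) < G123.card := lt_of_lt_of_le (by positivity) Mlow
  have K7 : 2 * (7 * ε * N) ≤ e ^ 2 * G123.card := by
    have h1 : e ^ 2 * (d ^ 4 / 2 * N) ≤ e ^ 2 * G123.card := by gcongr
    have h2 : ε * N ≤ e ^ 2 * d ^ 4 / 28 * N := mul_le_mul_of_nonneg_right hεb.le N0.le
    linarith
  constructor
  · refine bad_small G1 (fun v => ((G23.filter fun q => (v, q) ∈ G123).card : ℝ)) _ (7 * ε * N) e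
      n1 M0 he K7 ?_
    intro A hA
    have hfib : ∀ v ∈ A, ((G23.filter fun q => (v, q) ∈ G123).card : ℝ)
        = ∑ b ∈ G2 with (v, b) ∈ G12, f (v, b) := by
      intro v _
      rw [hf, ← Nat.cast_sum]
      congr 1
      rw [Finset.card_eq_sum_card_fiberwise (f := fun t : V2 × V3 => t.1)
        (t := G2.filter fun b => (v, b) ∈ G12)]
      · refine Finset.sum_congr rfl fun b _ => ?_
        refine Finset.card_bij (fun t _ => t.2) ?_ ?_ ?_
        · rintro ⟨b', c⟩ h
          simp only [Finset.mem_filter] at h ⊢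
          obtain ⟨⟨h0, h1⟩, rfl⟩ := h
          exact ⟨(mem3 _ h1).1, h1⟩
        · rintro ⟨a, c⟩ h ⟨a', c'⟩ h' hc
          simp only [Finset.mem_filter] at h h' hc
          rw [h.2, h'.2, hc]
        · intro w hw
          simp only [Finset.mem_filter] at hw
          have := h123 hw.2
          simp only [tri, Finset.mem_filter, Finset.mem_univ, true_and] at this
          exact ⟨(b, w), by simp [hw.2, this.2.2], rfl⟩
      · intro t ht
        have ht := Finset.mem_filter.1 (Finset.mem_coe.1 ht)
        have h1 := (mem3 _ ht.2).2
        exact Finset.mem_coe.2 (Finset.mem_filter.2 ⟨(Finset.mem_product.1 (h12 h1)).2, h1⟩)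
    set B := G12.filter fun p => p.1 ∈ A with hB
    have hBs : B ⊆ A ×ˢ G2 := by
      intro p hp
      have hp := Finset.mem_filter.1 hp
      exact Finset.mem_product.2 ⟨hp.2, (Finset.mem_product.1 (h12 hp.1)).2⟩
    have s1 : ∑ v ∈ A, ((G23.filter fun q => (v, q) ∈ G123).card : ℝ) = ∑ p ∈ B, f p := by
      rw [Finset.sum_congr rfl hfib]
      rw [sum_pairs A G2 B hBs (fun a b => f (a, b))]
      refine Finset.sum_congr rfl fun v hv => ?_
      simp [hB, hv]
    have s2 : |(B.card : ℝ) - z * (A.card * G2.card)| ≤ ε * (G1.card * G2.card) := by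
      have h := D12 A hA G2 (Finset.Subset.refl _)
      have h2 : ∑ a ∈ A, ∑ b ∈ G2, ((if (a, b) ∈ G12 then (1:ℝ) else 0) - z)
          = (B.card : ℝ) - z * (A.card * G2.card) := by
        simp only [Finset.sum_sub_distrib]
        have h3 : (B.card : ℝ) = ∑ p ∈ B, (1:ℝ) := by simp
        rw [h3, sum_pairs A G2 B hBs (fun _ _ => (1:ℝ))]
        congr 1
        · refine Finset.sum_congr rfl fun v hv => ?_
          rw [Finset.sum_filter]
          simp [hB, hv]
        · simp; ring
      rwa [h2] at h
    have p := P' B (Finset.filter_subset _ _)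
    show |∑ v ∈ A, ((G23.filter fun q => (v, q) ∈ G123).card : ℝ) - _| ≤ _
    rw [s1]
    have e1 : ∑ p ∈ B, f p - G123.card * A.card / G1.card =
        (∑ p ∈ B, f p - G123.card * B.card / G12.card) +
          (G123.card / G12.card : ℝ) * (B.card - z * (A.card * G2.card)) := by
      rw [hz]
      field_simp
      ring
    rw [e1]
    refine (abs_add_le _ _).trans ?_
    rw [abs_mul, abs_of_nonneg (by positivity : (0:ℝ) ≤ G123.card / G12.card)]
    have h3 : (G123.card : ℝ) / G12.card ≤ G3.card := by rwa [div_le_iff₀ n12]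
    have := mul_le_mul h3 s2 (abs_nonneg _) n3.le
    have e2 : (G3.card : ℝ) * (ε * (G1.card * G2.card)) = ε * N := by rw [hN]; ring
    linarith
  · refine bad_small G12 f _ (7 * ε * N) e n12 M0 he K7 ?_
    intro A hA
    have := P' A hA
    have : 0 < ε * N := by positivity
    linarith
end
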